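/- arXiv:1910.12778 — 9 statements merged into one kernel-verified Lean document; each statement's English description precedes it below -/
import Mathlib

section
/- Suppose (β*, s*, λ*) is an optimal solution of Problem (A), i.e., (β*, s*, λ*) is feasible for (A) and attains the minimum of the objective λε + (1/N)∑_{i=1}^N s_i over all feasible points. Then λ* ≤ 0.2785/ε. -/
theorem aux_exp : 1 ≤ (0.27848:ℝ) * Real.exp 1.27848 := by
  have h1 := Real.exp_one_gt_d9
  have h2 := Real.sum_le_exp_of_nonneg (x := (0.27848:ℝ)) (by norm_num) 7
  have h3 : Real.exp 1.27848 = Real.exp 1 * Real.exp 0.27848 := by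
    rw [← Real.exp_add]; norm_num
  have h4 : (1.3211:ℝ) ≤ Real.exp 0.27848 := by
    refine le_trans ?_ h2
    norm_num [Finset.sum_range_succ, Nat.factorial]
  rw [h3]
  nlinarith

theorem aux_M (v : ℝ) : v * (1 / (1 + Real.exp v)) ≤ 0.27848 := by
  have hp := Real.exp_pos v
  rw [mul_one_div, div_le_iff₀ (by positivity)]
  by_cases hv : v ≤ 0.27848
  · nlinarith
  · push Not at hv
    have h1 : Real.exp v = Real.exp 1.27848 * Real.exp (v - 1.27848) := by
      rw [← Real.exp_add]; congr 1; ring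
    have h2 := Real.add_one_le_exp (v - 1.27848)
    have h3 := aux_exp
    have h4 : Real.exp 1.27848 * (v - 0.27848) ≤ Real.exp v := by
      rw [h1]
      exact mul_le_mul_of_nonneg_left (by linarith) (Real.exp_pos _).le
    nlinarith

theorem aux_flip (u : ℝ) :
    Real.log (1 + Real.exp u) = Real.log (1 + Real.exp (-u)) + u := by
  have h : 1 + Real.exp u = (1 + Real.exp (-u)) * Real.exp u := by
    rw [add_mul, ← Real.exp_add]; simp [add_comm]
  rw [h, Real.log_mul (by positivity) (by positivity), Real.log_exp]

theorem aux_conv (w u : ℝ) :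
    Real.log (1 + Real.exp (-w)) - Real.log (1 + Real.exp (-u))
      ≤ (u - w) * (1 / (1 + Real.exp w)) := by
  set p := 1 / (1 + Real.exp w) with hp
  have hw := Real.exp_pos w
  have hp0 : 0 ≤ p := by positivity
  have hp1 : p ≤ 1 := by
    rw [hp, div_le_one (by positivity)]; linarith
  have hc := convexOn_exp.2 (Set.mem_univ (0:ℝ)) (Set.mem_univ (-(u - w)))
    (sub_nonneg.2 hp1) hp0 (by ring)
  simp only [smul_eq_mul, mul_zero, zero_add, Real.exp_zero, mul_one] at hc
  have e1 : (1 + Real.exp (-w)) * (1 - p + p * Real.exp (-(u - w))) = 1 + Real.exp (-u) := by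
    have : Real.exp (-(u - w)) = Real.exp (-u) * Real.exp w := by
      rw [← Real.exp_add]; congr 1; ring
    rw [this, hp, Real.exp_neg w]
    field_simp
    ring
  have h2 : Real.log ((1 + Real.exp (-w)) * Real.exp (p * -(u - w)))
      ≤ Real.log (1 + Real.exp (-u)) := by
    apply Real.log_le_log (by positivity)
    rw [← e1]
    exact mul_le_mul_of_nonneg_left hc (by positivity)
  rw [Real.log_mul (by positivity) (by positivity), Real.log_exp] at h2
  nlinarith

/-- Proposition 3.1: if `(β*, s*, λ*)` is an optimal solution of the DRLR
reformulation (Problem (A), with the `ℓ∞`-norm constraint `‖β‖_∞ ≤ λ`), then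
`λ* ≤ 0.2785 / ε`.  Here `X i : Fin n → ℝ` are the feature vectors,
`Y i ∈ {−1, +1}` the labels, and the `ℓ∞`-norm of `β : Fin n → ℝ` is the
(sup) norm `‖β‖` of the Pi type. -/
theorem drlr_optimal_lambda_upper_bound
    {n N : ℕ} (hn : 0 < n) (hN : 0 < N)
    (X : Fin N → (Fin n → ℝ)) (Y : Fin N → ℝ)
    (hY : ∀ i, Y i = 1 ∨ Y i = -1)
    (ε κ : ℝ) (hε : 0 < ε) (hκ : 0 < κ)
    (βs : Fin n → ℝ) (ss : Fin N → ℝ) (lams : ℝ)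
    (hfeas :
      (∀ i, Real.log (1 + Real.exp (-(Y i * ∑ j, βs j * X i j))) ≤ ss i) ∧
      (∀ i, Real.log (1 + Real.exp (Y i * ∑ j, βs j * X i j)) - lams * κ ≤ ss i) ∧
      ‖βs‖ ≤ lams)
    (hopt : ∀ (β : Fin n → ℝ) (s : Fin N → ℝ) (lam : ℝ),
      ((∀ i, Real.log (1 + Real.exp (-(Y i * ∑ j, β j * X i j))) ≤ s i) ∧
       (∀ i, Real.log (1 + Real.exp (Y i * ∑ j, β j * X i j)) - lam * κ ≤ s i) ∧
       ‖β‖ ≤ lam) →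
      lams * ε + (1 / (N : ℝ)) * ∑ i, ss i ≤ lam * ε + (1 / (N : ℝ)) * ∑ i, s i) :
    lams ≤ 0.2785 / ε := by
  obtain ⟨f1, f2, f3⟩ := hfeas
  obtain ⟨t, ht⟩ : ∃ t : ℝ, t = 0.27848 / 0.2785 := ⟨_, rfl⟩
  have ht0 : 0 < t := by rw [ht]; norm_num
  have ht1 : 0 < 1 - t := by rw [ht]; norm_num
  have htM : t * 0.2785 = 0.27848 := by rw [ht]; norm_num
  set u : Fin N → ℝ := fun i => Y i * ∑ j, βs j * X i j with hu
  have hsc : ∀ i, Y i * ∑ j, (t • βs) j * X i j = t * u i := by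
    intro i
    simp only [hu, Pi.smul_apply, smul_eq_mul, mul_assoc]
    rw [← Finset.mul_sum]; ring
  have key := hopt (t • βs)
    (fun i => Real.log (1 + Real.exp (-(t * u i))) + t * max 0 (u i - lams * κ)) (t * lams) ?_
  · have hi : ∀ i, Real.log (1 + Real.exp (-(t * u i))) + t * max 0 (u i - lams * κ)
        ≤ ss i + (1 - t) * 0.2785 := by
      intro i
      have a1 : Real.log (1 + Real.exp (-(u i))) ≤ ss i := f1 i
      have a2 : Real.log (1 + Real.exp (u i)) - lams * κ ≤ ss i := f2 i
      rw [aux_flip] at a2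
      have a3 : Real.log (1 + Real.exp (-(u i))) + max 0 (u i - lams * κ) ≤ ss i := by
        rcases max_cases (0:ℝ) (u i - lams * κ) with h | h <;> linarith
      have a4 := aux_conv (t * u i) (u i)
      have a5 := aux_M (t * u i)
      have a6 : u i * (1 / (1 + Real.exp (t * u i))) ≤ 0.2785 := by
        rw [← htM, mul_assoc] at a5
        exact le_of_mul_le_mul_left a5 ht0
      have a7 : 0 ≤ max 0 (u i - lams * κ) := le_max_left _ _
      have a8 := mul_le_mul_of_nonneg_left a6 ht1.le
      nlinarith [mul_nonneg ht1.le a7]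
    have hs := Finset.sum_le_sum (fun i (_ : i ∈ Finset.univ) => hi i)
    rw [Finset.sum_add_distrib (f := ss)] at hs
    simp only [Finset.sum_const, Finset.card_univ, Fintype.card_fin, nsmul_eq_mul] at hs
    have hN' : (0:ℝ) < N := by exact_mod_cast hN
    have hs2 := mul_le_mul_of_nonneg_left hs (one_div_pos.2 hN').le
    have e : (1 / (N:ℝ)) * (∑ i, ss i + N * ((1 - t) * 0.2785))
        = (1 / (N:ℝ)) * ∑ i, ss i + (1 - t) * 0.2785 := by
      field_simp
    rw [e] at hs2
    rw [le_div_iff₀ hε]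
    have : (1 - t) * (lams * ε) ≤ (1 - t) * 0.2785 := by linarith
    exact le_of_mul_le_mul_left this ht1
  · refine ⟨fun i => ?_, fun i => ?_, ?_⟩
    · rw [hsc]
      have := mul_nonneg ht0.le (le_max_left 0 (u i - lams * κ))
      linarith
    · rw [hsc, aux_flip]
      have := mul_le_mul_of_nonneg_left (le_max_right 0 (u i - lams * κ)) ht0.le
      linarith
    · rw [norm_smul, Real.norm_of_nonneg ht0.le]
      exact mul_le_mul_of_nonneg_left f3 ht0.le
end

section
/- Suppose (β*, s*, λ*) is an optimal solution of Problem (A), i.e., (β*, s*, λ*) is feasible for (A) and attains the minimum of the objective λε + (1/N)∑_{i=1}^N s_i over all feasible points. Then ε·λ* ≤ (1/N)∑_{i=1}^N t_i·exp(−t_i)/(1+exp(−t_i)), where t_i = ŷ_i⟨β*, x̂_i⟩. -/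
/-- The central inequality in the proof of Proposition 3.1: if `(β*, s*, λ*)` is
an optimal solution of Problem (A) (with the `ℓ∞`-norm constraint `‖β‖_∞ ≤ λ`),
then `ε·λ* ≤ (1/N) ∑ i, t_i·exp(−t_i)/(1+exp(−t_i))` where
`t_i = ŷ_i ⟨β*, x̂_i⟩`. -/
theorem drlr_optimal_lambda_kkt_bound
    {n N : ℕ} (hn : 0 < n) (hN : 0 < N)
    (X : Fin N → (Fin n → ℝ)) (Y : Fin N → ℝ)
    (hY : ∀ i, Y i = 1 ∨ Y i = -1)
    (ε κ : ℝ) (hε : 0 < ε) (hκ : 0 < κ)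
    (βs : Fin n → ℝ) (ss : Fin N → ℝ) (lams : ℝ)
    (hfeas :
      (∀ i, Real.log (1 + Real.exp (-(Y i * ∑ j, βs j * X i j))) ≤ ss i) ∧
      (∀ i, Real.log (1 + Real.exp (Y i * ∑ j, βs j * X i j)) - lams * κ ≤ ss i) ∧
      ‖βs‖ ≤ lams)
    (hopt : ∀ (β : Fin n → ℝ) (s : Fin N → ℝ) (lam : ℝ),
      ((∀ i, Real.log (1 + Real.exp (-(Y i * ∑ j, β j * X i j))) ≤ s i) ∧
       (∀ i, Real.log (1 + Real.exp (Y i * ∑ j, β j * X i j)) - lam * κ ≤ s i) ∧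
       ‖β‖ ≤ lam) →
      lams * ε + (1 / (N : ℝ)) * ∑ i, ss i ≤ lam * ε + (1 / (N : ℝ)) * ∑ i, s i) :
    ε * lams ≤ (1 / (N : ℝ)) * ∑ i,
      (Y i * ∑ j, βs j * X i j) * Real.exp (-(Y i * ∑ j, βs j * X i j)) /
        (1 + Real.exp (-(Y i * ∑ j, βs j * X i j))) := by
  obtain ⟨h1, h2, h3⟩ := hfeas
  have hNpos : (0:ℝ) < N := by exact_mod_cast hN
  have key : ∀ u : ℝ, Real.log (1 + Real.exp u) = Real.log (1 + Real.exp (-u)) + u := by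
    intro u
    have e : 1 + Real.exp u = (1 + Real.exp (-u)) * Real.exp u := by
      rw [add_mul, ← Real.exp_add]; simp [add_comm]
    rw [e, Real.log_mul (by positivity) (by positivity), Real.log_exp]
  set t : Fin N → ℝ := fun i => Y i * ∑ j, βs j * X i j with ht
  set m : Fin N → ℝ := fun i => max 0 (t i - lams * κ) with hm
  have hm0 : ∀ i, 0 ≤ m i := fun i => le_max_left _ _
  have hm1 : ∀ i, t i - lams * κ ≤ m i := fun i => le_max_right _ _
  have hss : ∀ i, Real.log (1 + Real.exp (-(t i))) + m i ≤ ss i := by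
    intro i
    have a := h1 i
    have b := h2 i
    rw [key] at b
    change Real.log (1 + Real.exp (-(t i))) ≤ ss i at a
    change Real.log (1 + Real.exp (-(t i))) + t i - lams * κ ≤ ss i at b
    rcases max_choice 0 (t i - lams * κ) with h | h
    · have : m i = 0 := h
      linarith
    · have : m i = t i - lams * κ := h
      linarith
  set F : ℝ → ℝ := fun c => c * (lams * ε) +
    (1 / (N : ℝ)) * ∑ i, (Real.log (1 + Real.exp (-(c * t i))) + c * m i) with hF
  have hmin : ∀ c : ℝ, 0 ≤ c → F 1 ≤ F c := by
    intro c hc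
    have hs : ∀ i, Y i * ∑ j, (c • βs) j * X i j = c * t i := by
      intro i
      simp only [ht, Pi.smul_apply, smul_eq_mul, mul_assoc, ← Finset.mul_sum]
      ring
    have h := hopt (c • βs) (fun i => Real.log (1 + Real.exp (-(c * t i))) + c * m i) (c * lams)
      ⟨fun i => by
          rw [hs]
          have := mul_nonneg hc (hm0 i)
          linarith,
        fun i => by
          rw [hs, key]
          have := mul_le_mul_of_nonneg_left (hm1 i) hc
          linarith,
        by
          rw [norm_smul, Real.norm_of_nonneg hc]
          exact mul_le_mul_of_nonneg_left h3 hc⟩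
    have h' : (1 / (N : ℝ)) * ∑ i, (Real.log (1 + Real.exp (-(t i))) + m i)
        ≤ (1 / (N : ℝ)) * ∑ i, ss i :=
      mul_le_mul_of_nonneg_left (Finset.sum_le_sum fun i _ => hss i) (by positivity)
    simp only [hF, one_mul]
    linarith
  have hloc : IsLocalMin F 1 := by
    filter_upwards [lt_mem_nhds (zero_lt_one : (0:ℝ) < 1)] with c hc
    exact hmin c hc.le
  have hd : HasDerivAt F (1 * (lams * ε) + (1 / (N : ℝ)) *
      ∑ i, (Real.exp (-(1 * t i)) * (-(1 * t i)) / (1 + Real.exp (-(1 * t i))) + 1 * m i)) 1 := by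
    refine ((hasDerivAt_id (1:ℝ)).mul_const _).add (HasDerivAt.const_mul _ ?_)
    refine HasDerivAt.fun_sum fun i _ => ?_
    refine HasDerivAt.add ?_ ((hasDerivAt_id (1:ℝ)).mul_const _)
    refine HasDerivAt.log ?_ (by positivity)
    exact (((hasDerivAt_id (1:ℝ)).mul_const (t i)).neg.exp).const_add 1
  have h0 := hloc.hasDerivAt_eq_zero hd
  simp only [one_mul, Finset.sum_add_distrib, mul_add] at h0
  have hms : 0 ≤ (1 / (N : ℝ)) * ∑ i, m i :=
    mul_nonneg (by positivity) (Finset.sum_nonneg fun i _ => hm0 i)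
  have hneg : ∑ i, Real.exp (-(t i)) * (-(t i)) / (1 + Real.exp (-(t i)))
      = - ∑ i, t i * Real.exp (-(t i)) / (1 + Real.exp (-(t i))) := by
    rw [← Finset.sum_neg_distrib]
    exact Finset.sum_congr rfl fun i _ => by ring
  rw [hneg] at h0
  change ε * lams ≤ (1 / (N : ℝ)) * ∑ i, t i * Real.exp (-(t i)) / (1 + Real.exp (-(t i)))
  linarith
end

section
/- Define q : [0, ∞) → ℝ by q(λ) = inf over β ∈ ℝ^n with ‖β‖_∞ ≤ λ of [λε + (1/N)∑_{i=1}^N (log(1 + exp(−ŷ_i⟨β, x̂_i⟩)) + max{ŷ_i⟨β, x̂_i⟩ − λκ, 0})]. Then q is convex on [0, ∞). -/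
lemma softplus_convex (s t a b : ℝ) (ha : 0 ≤ a) (hb : 0 ≤ b) (hab : a + b = 1) :
    Real.log (1 + Real.exp (a * s + b * t)) ≤
      a * Real.log (1 + Real.exp s) + b * Real.log (1 + Real.exp t) := by
  have hs : 0 < 1 + Real.exp s := by positivity
  have ht : 0 < 1 + Real.exp t := by positivity
  set A := Real.log (1 + Real.exp s) with hA
  set B := Real.log (1 + Real.exp t) with hB
  have eA : Real.exp A = 1 + Real.exp s := Real.exp_log hs
  have eB : Real.exp B = 1 + Real.exp t := Real.exp_log ht
  have h1 := convexOn_exp.2 (Set.mem_univ (-A)) (Set.mem_univ (-B)) ha hb hab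
  have h2 := convexOn_exp.2 (Set.mem_univ (s - A)) (Set.mem_univ (t - B)) ha hb hab
  simp only [smul_eq_mul] at h1 h2
  have kA : Real.exp (-A) + Real.exp (s - A) = 1 := by
    rw [Real.exp_neg, Real.exp_sub, eA]; field_simp
  have kB : Real.exp (-B) + Real.exp (t - B) = 1 := by
    rw [Real.exp_neg, Real.exp_sub, eB]; field_simp
  have h3 : Real.exp (a * -A + b * -B) + Real.exp (a * (s - A) + b * (t - B)) ≤ 1 := by
    calc _ ≤ a * (Real.exp (-A) + Real.exp (s - A)) + b * (Real.exp (-B) + Real.exp (t - B)) := by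
          linarith
      _ = 1 := by rw [kA, kB]; linarith
  have e1 : Real.exp (a * -A + b * -B) * Real.exp (a * A + b * B) = 1 := by
    rw [← Real.exp_add, ← Real.exp_zero]; congr 1; ring
  have e2 : Real.exp (a * (s - A) + b * (t - B)) * Real.exp (a * A + b * B)
      = Real.exp (a * s + b * t) := by
    rw [← Real.exp_add]; congr 1; ring
  rw [Real.log_le_iff_le_exp (by positivity)]
  have h4 := mul_le_mul_of_nonneg_right h3 (Real.exp_pos (a * A + b * B)).le
  rw [add_mul, e1, e2, one_mul] at h4
  exact h4

lemma value_convex {E : Type*} [NormedAddCommGroup E] [NormedSpace ℝ E] (F : ℝ → E → ℝ)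
    (hF0 : ∀ l, 0 ≤ l → ∀ β, 0 ≤ F l β)
    (hF : ∀ x y β γ a b, 0 ≤ a → 0 ≤ b → a + b = 1 →
      F (a * x + b * y) (a • β + b • γ) ≤ a * F x β + b * F y γ) :
    ConvexOn ℝ (Set.Ici (0 : ℝ)) (fun l => sInf (F l '' {β : E | ‖β‖ ≤ l})) := by
  refine ⟨convex_Ici 0, ?_⟩
  intro x hx y hy a b ha hb hab
  simp only [Set.mem_Ici] at hx hy
  simp only [smul_eq_mul]
  have ne : ∀ l : ℝ, 0 ≤ l → (F l '' {β : E | ‖β‖ ≤ l}).Nonempty := fun l hl =>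
    ⟨_, 0, by simpa using hl, rfl⟩
  refine le_of_forall_pos_le_add fun δ hδ => ?_
  obtain ⟨_, ⟨β, hβ, rfl⟩, h1⟩ := Real.lt_sInf_add_pos (ne x hx) hδ
  obtain ⟨_, ⟨γ, hγ, rfl⟩, h2⟩ := Real.lt_sInf_add_pos (ne y hy) hδ
  simp only [Set.mem_ofPred_eq] at hβ hγ
  have hl : 0 ≤ a * x + b * y := by positivity
  have hmem : ‖a • β + b • γ‖ ≤ a * x + b * y := by
    refine (norm_add_le _ _).trans ?_
    rw [norm_smul, norm_smul, Real.norm_of_nonneg ha, Real.norm_of_nonneg hb]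
    gcongr
  have hbdd : BddBelow (F (a * x + b * y) '' {β : E | ‖β‖ ≤ a * x + b * y}) :=
    ⟨0, by rintro _ ⟨β, -, rfl⟩; exact hF0 _ hl β⟩
  have h0 := csInf_le hbdd ⟨_, hmem, rfl⟩
  have h3 := hF x y β γ a b ha hb hab
  have h4 := mul_le_mul_of_nonneg_left h1.le ha
  have h5 := mul_le_mul_of_nonneg_left h2.le hb
  have h6 : a * δ + b * δ = δ := by rw [← add_mul, hab, one_mul]
  linarith

/-- Convexity of the value function `q(λ)` (Lemma A.1 applied to the DRLR
problem): `q(λ) = inf { λε + (1/N) ∑ᵢ (log(1+exp(−ŷᵢ⟨β,x̂ᵢ⟩)) +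
max(ŷᵢ⟨β,x̂ᵢ⟩ − λκ, 0)) : ‖β‖_∞ ≤ λ }` is convex on `[0, ∞)`. -/
theorem drlr_value_function_convex
    {n N : ℕ} (hn : 0 < n) (hN : 0 < N)
    (X : Fin N → (Fin n → ℝ)) (Y : Fin N → ℝ)
    (hY : ∀ i, Y i = 1 ∨ Y i = -1)
    (ε κ : ℝ) (hε : 0 < ε) (hκ : 0 < κ) :
    ConvexOn ℝ (Set.Ici (0 : ℝ))
      (fun lam => sInf ((fun β : Fin n → ℝ =>
        lam * ε + (1 / (N : ℝ)) * ∑ i,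
          (Real.log (1 + Real.exp (-(Y i * ∑ j, β j * X i j))) +
            max (Y i * ∑ j, β j * X i j - lam * κ) 0)) ''
        {β : Fin n → ℝ | ‖β‖ ≤ lam})) := by
  refine value_convex (fun lam (β : Fin n → ℝ) =>
        lam * ε + (1 / (N : ℝ)) * ∑ i,
          (Real.log (1 + Real.exp (-(Y i * ∑ j, β j * X i j))) +
            max (Y i * ∑ j, β j * X i j - lam * κ) 0)) ?_ ?_
  · intro l hl β
    have : 0 ≤ ∑ i, (Real.log (1 + Real.exp (-(Y i * ∑ j, β j * X i j))) +
            max (Y i * ∑ j, β j * X i j - l * κ) 0) := by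
      refine Finset.sum_nonneg fun i _ => add_nonneg (Real.log_nonneg ?_) (le_max_right _ _)
      linarith [Real.exp_pos (-(Y i * ∑ j, β j * X i j))]
    positivity
  · intro x y β γ a b ha hb hab
    have key : ∀ i, (Real.log (1 + Real.exp (-(Y i * ∑ j, (a • β + b • γ) j * X i j))) +
            max (Y i * ∑ j, (a • β + b • γ) j * X i j - (a * x + b * y) * κ) 0) ≤
        a * (Real.log (1 + Real.exp (-(Y i * ∑ j, β j * X i j))) +
            max (Y i * ∑ j, β j * X i j - x * κ) 0) +
        b * (Real.log (1 + Real.exp (-(Y i * ∑ j, γ j * X i j))) +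
            max (Y i * ∑ j, γ j * X i j - y * κ) 0) := by
      intro i
      have e : Y i * ∑ j, (a • β + b • γ) j * X i j =
          a * (Y i * ∑ j, β j * X i j) + b * (Y i * ∑ j, γ j * X i j) := by
        have : ∑ j, (a • β + b • γ) j * X i j =
            a * ∑ j, β j * X i j + b * ∑ j, γ j * X i j := by
          rw [Finset.mul_sum, Finset.mul_sum, ← Finset.sum_add_distrib]
          refine Finset.sum_congr rfl fun j _ => ?_
          simp only [Pi.add_apply, Pi.smul_apply, smul_eq_mul]
          ring
        rw [this]; ring
      rw [e]
      generalize Y i * ∑ j, β j * X i j = s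
      generalize Y i * ∑ j, γ j * X i j = t
      have h1 := softplus_convex (-s) (-t) a b ha hb hab
      rw [show a * -s + b * -t = -(a * s + b * t) by ring] at h1
      have h2 : max (a * s + b * t - (a * x + b * y) * κ) 0 ≤
          a * max (s - x * κ) 0 + b * max (t - y * κ) 0 := by
        refine max_le ?_ (by positivity)
        have := mul_le_mul_of_nonneg_left (le_max_left (s - x * κ) 0) ha
        have := mul_le_mul_of_nonneg_left (le_max_left (t - y * κ) 0) hb
        linarith
      linarith
    have hs := Finset.sum_le_sum fun i (_ : i ∈ Finset.univ) => key i
    replace hs := hs.trans_eq Finset.sum_add_distrib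
    rw [← Finset.mul_sum, ← Finset.mul_sum] at hs
    have := mul_le_mul_of_nonneg_left hs (by positivity : (0 : ℝ) ≤ 1 / (N : ℝ))
    beta_reduce
    linarith
end

section
/- Let x₁, x₂ ∈ ℝ^n, y₀, w₀ ∈ ℝ^N. Suppose y₁ is a minimizer over ℝ^N of y ↦ (ρ/2)‖y − (Ax₁ − (w₀ + ∇f(y₀))/ρ)‖² + P(y), that w₁ = w₀ − ρ(Ax₁ − y₁), and that y₂ is a minimizer over ℝ^N of y ↦ (ρ/2)‖y − (Ax₂ − (w₁ + ∇f(y₁))/ρ)‖² + P(y). Then ‖Ax₂ − y₁‖² ≥ (1/2)‖y₂ − y₁‖² − (L_f²/ρ²)‖y₁ − y₀‖². -/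
open scoped RealInnerProductSpace

/-- Optimality of a proximal point tested along a segment. -/
theorem prox_var_ineq {E : Type*} [NormedAddCommGroup E] [InnerProductSpace ℝ E]
    (P : E → ℝ) (hP : ConvexOn ℝ Set.univ P) (ρ : ℝ) (c y z : E)
    (hy : IsMinOn (fun z => ρ / 2 * ‖z - c‖ ^ 2 + P z) Set.univ y)
    (t : ℝ) (ht : 0 < t) (ht1 : t ≤ 1) :
    0 ≤ ρ * ⟪y - c, z - y⟫ + ρ / 2 * t * ‖z - y‖ ^ 2 + (P z - P y) := by
  have h1 := hy (Set.mem_univ ((1 - t) • y + t • z))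
  simp only [Set.mem_setOf_eq] at h1
  have h2 := hP.2 (Set.mem_univ y) (Set.mem_univ z) (by linarith : 0 ≤ 1 - t) ht.le (by ring)
  simp only [smul_eq_mul] at h2
  have h3 : (1 - t) • y + t • z - c = (y - c) + t • (z - y) := by module
  rw [h3, norm_add_sq_real, inner_smul_right, norm_smul, mul_pow, Real.norm_eq_abs, sq_abs] at h1
  have h4 : 0 ≤ t * (ρ * ⟪y - c, z - y⟫ + ρ / 2 * t * ‖z - y‖ ^ 2 + (P z - P y)) := by
    nlinarith
  exact nonneg_of_mul_nonneg_right h4 ht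

/-- Proximal maps are nonexpansive. -/
theorem prox_nonexp {E : Type*} [NormedAddCommGroup E] [InnerProductSpace ℝ E]
    (P : E → ℝ) (hP : ConvexOn ℝ Set.univ P) (ρ : ℝ) (hρ : 0 < ρ) (c₁ c₂ y₁ y₂ : E)
    (h₁ : IsMinOn (fun z => ρ / 2 * ‖z - c₁‖ ^ 2 + P z) Set.univ y₁)
    (h₂ : IsMinOn (fun z => ρ / 2 * ‖z - c₂‖ ^ 2 + P z) Set.univ y₂) :
    ‖y₂ - y₁‖ ≤ ‖c₂ - c₁‖ := by
  have key : ∀ t : ℝ, 0 < t → t ≤ 1 → (1 - t) * ‖y₂ - y₁‖ ≤ ‖c₂ - c₁‖ := by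
    intro t ht ht1
    have a := prox_var_ineq P hP ρ c₁ y₁ y₂ h₁ t ht ht1
    have b := prox_var_ineq P hP ρ c₂ y₂ y₁ h₂ t ht ht1
    rw [norm_sub_rev y₁ y₂] at b
    have e : ⟪y₁ - c₁, y₂ - y₁⟫ + ⟪y₂ - c₂, y₁ - y₂⟫
        = ⟪c₂ - c₁, y₂ - y₁⟫ - ‖y₂ - y₁‖ ^ 2 := by
      rw [← real_inner_self_eq_norm_sq, ← neg_sub y₂ y₁, inner_neg_right, ← sub_eq_add_neg,
        ← inner_sub_left, ← inner_sub_left]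
      congr 1
      abel
    have cs := real_inner_le_norm (c₂ - c₁) (y₂ - y₁)
    have m : 0 ≤ ρ * (⟪c₂ - c₁, y₂ - y₁⟫ - ‖y₂ - y₁‖ ^ 2 + t * ‖y₂ - y₁‖ ^ 2) := by
      rw [← e]; linarith
    have m' := nonneg_of_mul_nonneg_right m hρ
    rcases (norm_nonneg (y₂ - y₁)).eq_or_lt with h0 | h0
    · rw [← h0]; simp
    · refine le_of_mul_le_mul_right ?_ h0
      nlinarith
  have hn := norm_nonneg (y₂ - y₁)
  by_contra! hlt
  have hpos : 0 < ‖y₂ - y₁‖ := lt_of_le_of_lt (norm_nonneg _) hlt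
  have hc := norm_nonneg (c₂ - c₁)
  have := key ((‖y₂ - y₁‖ - ‖c₂ - c₁‖) / (2 * ‖y₂ - y₁‖)) (by apply div_pos <;> linarith)
    (by rw [div_le_one (by linarith)]; linarith)
  have e : (1 - (‖y₂ - y₁‖ - ‖c₂ - c₁‖) / (2 * ‖y₂ - y₁‖)) * ‖y₂ - y₁‖
      = (‖y₂ - y₁‖ + ‖c₂ - c₁‖) / 2 := by
    field_simp
    ring
  linarith

/-- Lemma A.2 / Proposition 4.1(a): one LP-ADMM `y`-update followed by the dual
update and the next `y`-update satisfy
`‖Ax₂ − y₁‖² ≥ (1/2)‖y₂ − y₁‖² − (L_f²/ρ²)‖y₁ − y₀‖²`. -/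
theorem lpadmm_y_update_lower_bound
    {n N : ℕ} (hn : 0 < n) (hN : 0 < N)
    (A : EuclideanSpace ℝ (Fin n) →L[ℝ] EuclideanSpace ℝ (Fin N))
    (C : Set (EuclideanSpace ℝ (Fin n)))
    (hCne : C.Nonempty) (hCconv : Convex ℝ C) (hCclosed : IsClosed C)
    (P : EuclideanSpace ℝ (Fin N) → ℝ) (hP : ConvexOn ℝ Set.univ P)
    (f : EuclideanSpace ℝ (Fin N) → ℝ) (hf : ConvexOn ℝ Set.univ f)
    (f' : EuclideanSpace ℝ (Fin N) → EuclideanSpace ℝ (Fin N))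
    (hgrad : ∀ z, HasGradientAt f (f' z) z)
    (Lf : ℝ) (hLf : 0 < Lf)
    (hlip : ∀ a b, ‖f' a - f' b‖ ≤ Lf * ‖a - b‖)
    (ρ : ℝ) (hρ : 0 < ρ)
    (x₁ x₂ : EuclideanSpace ℝ (Fin n))
    (y₀ y₁ y₂ w₀ w₁ : EuclideanSpace ℝ (Fin N))
    (hy₁ : IsMinOn (fun z => ρ / 2 * ‖z - (A x₁ - ρ⁻¹ • (w₀ + f' y₀))‖ ^ 2 + P z)
      Set.univ y₁)
    (hw₁ : w₁ = w₀ - ρ • (A x₁ - y₁))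
    (hy₂ : IsMinOn (fun z => ρ / 2 * ‖z - (A x₂ - ρ⁻¹ • (w₁ + f' y₁))‖ ^ 2 + P z)
      Set.univ y₂) :
    ‖A x₂ - y₁‖ ^ 2 ≥ 1 / 2 * ‖y₂ - y₁‖ ^ 2 - Lf ^ 2 / ρ ^ 2 * ‖y₁ - y₀‖ ^ 2 := by
  have h := prox_nonexp P hP ρ hρ _ _ y₁ y₂ hy₁ hy₂
  have e : (A x₂ - ρ⁻¹ • (w₁ + f' y₁)) - (A x₁ - ρ⁻¹ • (w₀ + f' y₀))
      = (A x₂ - y₁) - ρ⁻¹ • (f' y₁ - f' y₀) := by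
    rw [hw₁]
    have : ρ⁻¹ • (w₀ - ρ • (A x₁ - y₁) + f' y₁) = ρ⁻¹ • (w₀ + f' y₁) - (A x₁ - y₁) := by
      rw [show w₀ - ρ • (A x₁ - y₁) + f' y₁ = (w₀ + f' y₁) - ρ • (A x₁ - y₁) by abel,
        smul_sub, inv_smul_smul₀ hρ.ne']
    rw [this]
    module
  rw [e] at h
  have h2 := h.trans (norm_sub_le _ _)
  have h3 : ‖ρ⁻¹ • (f' y₁ - f' y₀)‖ ≤ Lf / ρ * ‖y₁ - y₀‖ := by
    rw [norm_smul, Real.norm_eq_abs, abs_of_pos (inv_pos.2 hρ)]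
    calc _ ≤ ρ⁻¹ * (Lf * ‖y₁ - y₀‖) :=
          mul_le_mul_of_nonneg_left (hlip _ _) (inv_pos.2 hρ).le
      _ = _ := by ring
  have h4 : ‖y₂ - y₁‖ ≤ ‖A x₂ - y₁‖ + Lf / ρ * ‖y₁ - y₀‖ := by linarith
  have h5 := pow_le_pow_left₀ (norm_nonneg _) h4 2
  rw [← div_pow, ← mul_pow]
  nlinarith [sq_nonneg (‖A x₂ - y₁‖ - Lf / ρ * ‖y₁ - y₀‖)]
end

section
/- Let x⁺ ∈ ℝ^n, y₀, w₀ ∈ ℝ^N. Suppose y⁺ is a minimizer over ℝ^N of y ↦ (ρ/2)‖y − (Ax⁺ − (w₀ + ∇f(y₀))/ρ)‖² + P(y), and set w⁺ = w₀ − ρ(Ax⁺ − y⁺). Then for every y ∈ ℝ^N, f(y⁺) + P(y⁺) − f(y) − P(y) ≤ ⟨∇f(y⁺) − ∇f(y₀), y⁺ − y⟩ − ⟨w⁺, y⁺ − y⟩. -/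
open scoped RealInnerProductSpace

/-- The `y`-update inequality in the proof of Lemma A.3 (Proposition 4.1(b)):
if `y⁺` minimizes `y ↦ (ρ/2)‖y − (Ax⁺ − (w₀ + ∇f(y₀))/ρ)‖² + P(y)` and
`w⁺ = w₀ − ρ(Ax⁺ − y⁺)`, then for every `y`,
`f(y⁺) + P(y⁺) − f(y) − P(y) ≤ ⟨∇f(y⁺) − ∇f(y₀), y⁺ − y⟩ − ⟨w⁺, y⁺ − y⟩`. -/
theorem lpadmm_y_update_inequality
    {n N : ℕ} (hn : 0 < n) (hN : 0 < N)
    (A : EuclideanSpace ℝ (Fin n) →L[ℝ] EuclideanSpace ℝ (Fin N))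
    (C : Set (EuclideanSpace ℝ (Fin n)))
    (hCne : C.Nonempty) (hCconv : Convex ℝ C) (hCclosed : IsClosed C)
    (P : EuclideanSpace ℝ (Fin N) → ℝ) (hP : ConvexOn ℝ Set.univ P)
    (f : EuclideanSpace ℝ (Fin N) → ℝ) (hf : ConvexOn ℝ Set.univ f)
    (f' : EuclideanSpace ℝ (Fin N) → EuclideanSpace ℝ (Fin N))
    (hgrad : ∀ z, HasGradientAt f (f' z) z)
    (Lf : ℝ) (hLf : 0 < Lf)
    (hlip : ∀ a b, ‖f' a - f' b‖ ≤ Lf * ‖a - b‖)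
    (ρ : ℝ) (hρ : 0 < ρ)
    (xp : EuclideanSpace ℝ (Fin n)) (y₀ w₀ yp wp : EuclideanSpace ℝ (Fin N))
    (hyp : IsMinOn (fun z => ρ / 2 * ‖z - (A xp - ρ⁻¹ • (w₀ + f' y₀))‖ ^ 2 + P z)
      Set.univ yp)
    (hwp : wp = w₀ - ρ • (A xp - yp)) :
    ∀ y : EuclideanSpace ℝ (Fin N),
      f yp + P yp - f y - P y ≤ ⟪f' yp - f' y₀, yp - y⟫ - ⟪wp, yp - y⟫ := by
  intro y
  -- gradient inequality for `f`
  have h1 : f yp - f y ≤ ⟪f' yp, yp - y⟫ := by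
    have hc : ConvexOn ℝ Set.univ (f ∘ (AffineMap.lineMap yp y : ℝ →ᵃ[ℝ] _)) := by
      simpa using hf.comp_affineMap (AffineMap.lineMap yp y : ℝ →ᵃ[ℝ] _)
    have hd : HasDerivAt (f ∘ (AffineMap.lineMap yp y : ℝ →ᵃ[ℝ] _)) ⟪f' yp, y - yp⟫ (0 : ℝ) := by
      have hg : HasFDerivAt f (InnerProductSpace.toDual ℝ _ (f' yp))
          ((AffineMap.lineMap yp y : ℝ →ᵃ[ℝ] _) (0 : ℝ)) := by
        simpa using (hgrad yp).hasFDerivAt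
      have hl : HasDerivAt (AffineMap.lineMap yp y : ℝ →ᵃ[ℝ] _) (y - yp) (0 : ℝ) :=
        AffineMap.hasDerivAt_lineMap
      simpa using hg.comp_hasDerivAt (0 : ℝ) hl
    have := hc.le_slope_of_hasDerivAt (Set.mem_univ 0) (Set.mem_univ 1) one_pos hd
    simp [slope_def_field] at this
    simp only [inner_sub_right] at this ⊢
    linarith
  -- optimality condition
  have h2 : P yp - P y ≤ -⟪wp + f' y₀, yp - y⟫ := by
    set v := yp - (A xp - ρ⁻¹ • (w₀ + f' y₀)) with hv
    have hw : wp + f' y₀ = ρ • v := by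
      rw [hwp, hv]
      simp only [smul_sub, smul_smul, mul_inv_cancel₀ hρ.ne', one_smul]
      abel
    have key : ∀ t : ℝ, 0 < t → t ≤ 1 →
        0 ≤ (ρ * ⟪v, y - yp⟫ + (P y - P yp)) + t * (ρ / 2 * ‖y - yp‖ ^ 2) := by
      intro t ht ht1
      have hm := hyp (Set.mem_univ (yp + t • (y - yp)))
      simp only [Set.mem_setOf_eq] at hm
      have e1 : yp + t • (y - yp) - (A xp - ρ⁻¹ • (w₀ + f' y₀)) = v + t • (y - yp) := by
        rw [hv]; abel
      have e2 : yp + t • (y - yp) = (1 - t) • yp + t • y := by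
        module
      have hp := hP.2 (Set.mem_univ yp) (Set.mem_univ y) (sub_nonneg.2 ht1) ht.le (by ring)
      rw [e1, norm_add_sq_real, inner_smul_right, norm_smul, mul_pow, Real.norm_eq_abs, sq_abs,
        e2] at hm
      simp only [smul_eq_mul] at hp
      refine nonneg_of_mul_nonneg_right (a := t) ?_ ht
      rw [← hv] at hm
      nlinarith
    have h0 : 0 ≤ ρ * ⟪v, y - yp⟫ + (P y - P yp) := by
      by_contra! hneg
      set a := ρ * ⟪v, y - yp⟫ + (P y - P yp)
      have hb : 0 ≤ ρ / 2 * ‖y - yp‖ ^ 2 := by positivity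
      set b := ρ / 2 * ‖y - yp‖ ^ 2
      have hpos : 0 < b - a := by linarith
      have hk := key (-a / (b - a)) (div_pos (by linarith) hpos)
        ((div_le_one hpos).2 (by linarith))
      have : a + -a / (b - a) * b = -(a ^ 2) / (b - a) := by
        field_simp
        ring
      rw [this] at hk
      have : -(a ^ 2) / (b - a) < 0 := div_neg_of_neg_of_pos (by nlinarith) hpos
      linarith
    rw [hw, real_inner_smul_left]
    simp only [inner_sub_right] at h0 ⊢
    linarith
  rw [inner_sub_left]
  rw [inner_add_left] at h2
  linarith
end

section
/- Assume the iterates (x^k, y^k, w^k), k ≥ 0, are generated by LP-ADMM steps with constant penalty parameter ρ > (√3 + 1)·L_f, and set c = (ρ − 2L_f)/4. Then for every k ≥ 1 and every x ∈ C, y ∈ ℝ^N with Ax = y: F(x^{k+1}, y^{k+1}) − F(x, y) ≤ (1/(2ρ))(‖w^k‖² − ‖w^{k+1}‖²) + (ρ/2)(‖y^k − y‖² − ‖y^{k+1} − y‖²) + c(‖y^k − y^{k−1}‖² − ‖y^{k+1} − y^k‖²) + (B_f(y, y^{k+1}) − B_f(y, y^k)). -/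
open scoped RealInnerProductSpace


lemma aux_lim (a b : ℝ) (h : ∀ t : ℝ, 0 < t → t ≤ 1 → 0 ≤ t * a + t ^ 2 * b) : 0 ≤ a := by
  by_contra hc
  push Not at hc
  have hb : 0 < |b| + 1 := by positivity
  have ht : 0 < min 1 (-a / (2 * (|b| + 1))) :=
    lt_min one_pos (div_pos (by linarith) (by positivity))
  have h1 := h _ ht (min_le_left _ _)
  set t := min 1 (-a / (2 * (|b| + 1))) with htd
  have h2 : t ≤ -a / (2 * (|b| + 1)) := min_le_right _ _
  rw [le_div_iff₀ (by positivity)] at h2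
  have h3 : 0 ≤ t * (a + t * b) := by nlinarith
  have h4 : 0 ≤ a + t * b := nonneg_of_mul_nonneg_right h3 ht
  have h5 : t * b ≤ t * |b| := mul_le_mul_of_nonneg_left (le_abs_self b) ht.le
  nlinarith

section aux
variable {E : Type*} [NormedAddCommGroup E] [InnerProductSpace ℝ E]

lemma aux_proj {G : Type*} [NormedAddCommGroup G] [NormedSpace ℝ G] (A : G →L[ℝ] E) (C : Set G)
    (hC : Convex ℝ C) (q : E) (u z : G) (hu : u ∈ C) (hz : z ∈ C)
    (hmin : ∀ v ∈ C, ‖A u - q‖ ^ 2 ≤ ‖A v - q‖ ^ 2) :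
    0 ≤ ⟪A u - q, A z - A u⟫ := by
  have := aux_lim (2 * ⟪A u - q, A z - A u⟫) (‖A z - A u‖ ^ 2) (by
    intro t ht ht1
    have h := hmin (u + t • (z - u)) (hC.add_smul_sub_mem hu hz ⟨ht.le, ht1⟩)
    have e : A (u + t • (z - u)) - q = (A u - q) + t • (A z - A u) := by
      simp only [map_add, map_smul, map_sub]; abel
    rw [e, norm_add_sq_real, inner_smul_right, norm_smul, mul_pow, Real.norm_eq_abs, sq_abs] at h
    linarith)
  linarith

lemma aux_prox (P : E → ℝ) (hP : ConvexOn ℝ Set.univ P) (ρ : ℝ) (q u z : E)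
    (hmin : ∀ v, ρ / 2 * ‖u - q‖ ^ 2 + P u ≤ ρ / 2 * ‖v - q‖ ^ 2 + P v) :
    0 ≤ ρ * ⟪u - q, z - u⟫ + (P z - P u) := by
  refine aux_lim _ (ρ / 2 * ‖z - u‖ ^ 2) ?_
  intro t ht ht1
  have h := hmin (u + t • (z - u))
  have hc := hP.2 (Set.mem_univ u) (Set.mem_univ z) (by linarith : 0 ≤ 1 - t) ht.le (by ring)
  have e0 : (1 - t) • u + t • z = u + t • (z - u) := by module
  have e : u + t • (z - u) - q = (u - q) + t • (z - u) := by abel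
  rw [e0] at hc
  simp only [smul_eq_mul] at hc
  rw [e, norm_add_sq_real, inner_smul_right, norm_smul, mul_pow, Real.norm_eq_abs, sq_abs] at h
  linarith

variable [CompleteSpace E]

lemma aux_line (f : E → ℝ) (f' : E → E) (hgrad : ∀ z, HasGradientAt f (f' z) z) (y d : E)
    (t : ℝ) : HasDerivAt (fun s : ℝ => f (y + s • d)) ⟪f' (y + t • d), d⟫ t := by
  have h1 : HasDerivAt (fun s : ℝ => y + s • d) d t := by
    simpa using ((hasDerivAt_id t).smul_const d).const_add y
  have h2 := (hgrad (y + t • d)).hasFDerivAt.comp_hasDerivAt t h1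
  simpa [Function.comp_def] using h2

lemma aux_descent (f : E → ℝ) (f' : E → E) (hgrad : ∀ z, HasGradientAt f (f' z) z) (L : ℝ)
    (hlip : ∀ a b, ‖f' a - f' b‖ ≤ L * ‖a - b‖) (y z : E) :
    f z - f y - ⟪f' y, z - y⟫ ≤ L / 2 * ‖z - y‖ ^ 2 := by
  set d := z - y with hd
  have hder : ∀ t : ℝ, HasDerivAt
      (fun s : ℝ => f (y + s • d) - s * ⟪f' y, d⟫ - s ^ 2 * (L / 2 * ‖d‖ ^ 2))
      (⟪f' (y + t • d), d⟫ - ⟪f' y, d⟫ - 2 * t * (L / 2 * ‖d‖ ^ 2)) t := by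
    intro t
    have h1 := aux_line f f' hgrad y d t
    have h2 := (hasDerivAt_id t).mul_const ⟪f' y, d⟫
    have h3 := (hasDerivAt_pow 2 t).mul_const (L / 2 * ‖d‖ ^ 2)
    have h4 := (h1.sub h2).sub h3
    refine (h4.congr_deriv ?_)
    simp
  have hanti : AntitoneOn
      (fun s : ℝ => f (y + s • d) - s * ⟪f' y, d⟫ - s ^ 2 * (L / 2 * ‖d‖ ^ 2))
      (Set.Icc 0 1) := by
    apply antitoneOn_of_deriv_nonpos (convex_Icc 0 1)
    · exact fun t _ => (hder t).continuousAt.continuousWithinAt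
    · exact fun t _ => (hder t).differentiableAt.differentiableWithinAt
    · intro t ht
      rw [interior_Icc] at ht
      rw [(hder t).deriv]
      have h1 : ⟪f' (y + t • d) - f' y, d⟫ ≤ ‖f' (y + t • d) - f' y‖ * ‖d‖ :=
        real_inner_le_norm _ _
      have h2 := hlip (y + t • d) y
      rw [add_sub_cancel_left, norm_smul, Real.norm_eq_abs, abs_of_pos ht.1] at h2
      have h3 := mul_le_mul_of_nonneg_right h2 (norm_nonneg d)
      rw [inner_sub_left] at h1
      linarith
  have h := hanti (Set.left_mem_Icc.2 zero_le_one) (Set.right_mem_Icc.2 zero_le_one) zero_le_one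
  have e : y + d = z := by rw [hd]; abel
  simp [e] at h
  linarith

lemma aux_convex (f : E → ℝ) (hf : ConvexOn ℝ Set.univ f) (f' : E → E)
    (hgrad : ∀ z, HasGradientAt f (f' z) z) (y z : E) :
    0 ≤ f z - f y - ⟪f' y, z - y⟫ := by
  have hd := aux_line f f' hgrad y (z - y) 0
  have hc : ConvexOn ℝ Set.univ (fun s : ℝ => f (y + s • (z - y))) := by
    have := hf.comp_affineMap (AffineMap.lineMap (k := ℝ) y z)
    simpa [Function.comp_def, AffineMap.lineMap_apply, add_comm] using this
  have h := hc.le_slope_of_hasDerivAt (Set.mem_univ 0) (Set.mem_univ 1) one_pos hd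
  simp [slope_def_field] at h
  linarith

end aux

/-- Proposition 4.1(b): one-step function-value estimate for LP-ADMM iterates
with constant penalty `ρ > (√3 + 1)L_f`, where `F(x,y) = f(y) + P(y)`,
`c = (ρ − 2L_f)/4`, and `B_f` is the Bregman divergence of `f`. -/
theorem lpadmm_function_value_estimate
    {n N : ℕ} (hn : 0 < n) (hN : 0 < N)
    (A : EuclideanSpace ℝ (Fin n) →L[ℝ] EuclideanSpace ℝ (Fin N))
    (C : Set (EuclideanSpace ℝ (Fin n)))
    (hCne : C.Nonempty) (hCconv : Convex ℝ C) (hCclosed : IsClosed C)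
    (P : EuclideanSpace ℝ (Fin N) → ℝ) (hP : ConvexOn ℝ Set.univ P)
    (f : EuclideanSpace ℝ (Fin N) → ℝ) (hf : ConvexOn ℝ Set.univ f)
    (f' : EuclideanSpace ℝ (Fin N) → EuclideanSpace ℝ (Fin N))
    (hgrad : ∀ z, HasGradientAt f (f' z) z)
    (Lf : ℝ) (hLf : 0 < Lf)
    (hlip : ∀ a b, ‖f' a - f' b‖ ≤ Lf * ‖a - b‖)
    (ρ : ℝ) (hρ : (Real.sqrt 3 + 1) * Lf < ρ)
    (x : ℕ → EuclideanSpace ℝ (Fin n)) (y w : ℕ → EuclideanSpace ℝ (Fin N))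
    (hx : ∀ k, x (k+1) ∈ C ∧
      IsMinOn (fun u => ‖A u - y k - ρ⁻¹ • w k‖ ^ 2) C (x (k+1)))
    (hy : ∀ k, IsMinOn
      (fun z => ρ / 2 * ‖z - (A (x (k+1)) - ρ⁻¹ • (w k + f' (y k)))‖ ^ 2 + P z)
      Set.univ (y (k+1)))
    (hw : ∀ k, w (k+1) = w k - ρ • (A (x (k+1)) - y (k+1)))
    (Bf : EuclideanSpace ℝ (Fin N) → EuclideanSpace ℝ (Fin N) → ℝ)
    (hBf : ∀ u v, Bf u v = f u - f v - ⟪f' v, u - v⟫) :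
    ∀ k, 1 ≤ k → ∀ xx ∈ C, ∀ yy : EuclideanSpace ℝ (Fin N), A xx = yy →
      f (y (k+1)) + P (y (k+1)) - (f yy + P yy) ≤
        1 / (2 * ρ) * (‖w k‖ ^ 2 - ‖w (k+1)‖ ^ 2)
        + ρ / 2 * (‖y k - yy‖ ^ 2 - ‖y (k+1) - yy‖ ^ 2)
        + (ρ - 2 * Lf) / 4 * (‖y k - y (k-1)‖ ^ 2 - ‖y (k+1) - y k‖ ^ 2)
        + (Bf yy (y (k+1)) - Bf yy (y k)) := by
  intro k hk xx hxx yy hyy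
  obtain ⟨j, rfl⟩ : ∃ j, k = j + 1 := ⟨k - 1, by omega⟩
  simp only [Nat.add_sub_cancel]
  have hs3 : Real.sqrt 3 ^ 2 = 3 := Real.sq_sqrt (by norm_num)
  have hs0 : 0 ≤ Real.sqrt 3 := Real.sqrt_nonneg 3
  have hρ0 : 0 < ρ := lt_of_le_of_lt (by positivity) hρ
  have hρL : 2 * Lf ^ 2 ≤ ρ ^ 2 - 2 * Lf * ρ := by
    have h1 : Real.sqrt 3 * Lf ≤ ρ - Lf := by linarith
    have h2 := mul_self_le_mul_self (by positivity) h1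
    nlinarith
  -- optimality of the y-step
  have hPsub : ∀ m z, 0 ≤ ⟪w (m+1) + f' (y m), z - y (m+1)⟫ + (P z - P (y (m+1))) := by
    intro m z
    have h := aux_prox P hP ρ (A (x (m+1)) - ρ⁻¹ • (w m + f' (y m))) (y (m+1)) z
      (fun v => hy m (Set.mem_univ v))
    have e : ρ • (y (m+1) - (A (x (m+1)) - ρ⁻¹ • (w m + f' (y m)))) = w (m+1) + f' (y m) := by
      rw [hw m]
      simp only [smul_sub, smul_smul, mul_inv_cancel₀ hρ0.ne', one_smul]
      abel
    rwa [← real_inner_smul_left, e] at h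
  have hp1 := hPsub (j+1) yy
  have hm1 := hPsub (j+1) (y (j+1))
  have hm2 := hPsub j (y (j+1+1))
  -- optimality of the x-step
  have hX : 0 ≤ ⟪ρ • (y (j+1+1) - y (j+1)) - w (j+1+1), yy - A (x (j+1+1))⟫ := by
    have h := aux_proj A C hCconv (y (j+1) + ρ⁻¹ • w (j+1)) (x (j+1+1)) xx (hx (j+1)).1 hxx
      (fun v hv => by
        have := (hx (j+1)).2 hv
        simpa [sub_sub] using this)
    have h' := mul_nonneg hρ0.le h
    have e : ρ • (A (x (j+1+1)) - (y (j+1) + ρ⁻¹ • w (j+1)))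
        = ρ • (y (j+1+1) - y (j+1)) - w (j+1+1) := by
      rw [hw (j+1)]
      simp only [smul_sub, smul_add, smul_smul, mul_inv_cancel₀ hρ0.ne', one_smul]
      abel
    rwa [← real_inner_smul_left, e, hyy] at h'
  have hdes := aux_descent f f' hgrad Lf hlip (y (j+1)) (y (j+1+1))
  have hcv := aux_convex f hf f' hgrad (y (j+1+1)) yy
  have hL := hlip (y (j+1)) (y j)
  have hw1 := hw (j+1)
  rw [hBf, hBf]
  generalize y (j+1+1) = yp at *
  generalize y (j+1) = yc at *
  generalize y j = ym at *
  generalize w (j+1+1) = wp at *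
  generalize w (j+1) = wc at *
  obtain ⟨v, rfl⟩ : ∃ v, wp = wc + v := ⟨wp - wc, by abel⟩
  have ha : A (x (j+1+1)) = yp - ρ⁻¹ • v := by
    have e : v = ρ • (yp - A (x (j+1+1))) := by
      have := congrArg (fun s => s - wc) hw1
      simp only [add_sub_cancel_left] at this
      rw [this, smul_sub, smul_sub]; abel
    rw [e, smul_smul, inv_mul_cancel₀ hρ0.ne', one_smul]; abel
  rw [ha] at hX
  obtain ⟨d, rfl⟩ : ∃ d, yp = yc + d := ⟨yp - yc, by abel⟩
  obtain ⟨e, rfl⟩ : ∃ e, yy = yc + d + e := ⟨yy - (yc + d), by abel⟩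
  obtain ⟨g, hg⟩ : ∃ g, f' yc = f' ym + g := ⟨f' yc - f' ym, by abel⟩
  -- monotonicity of the subdifferential of P
  have hmono : ⟪v, d⟫ + ⟪g, d⟫ ≤ 0 := by
    have e1 : yc - (yc + d) = -d := by abel
    have e2 : yc + d - yc = d := by abel
    rw [hg, e1] at hm1
    rw [e2] at hm2
    simp only [inner_add_left, inner_neg_right] at hm1 hm2
    linarith
  have hgn : ‖g‖ ≤ Lf * ‖yc - ym‖ := by
    rw [hg, add_sub_cancel_left] at hL; exact hL
  have hgd : -⟪g, d⟫ ≤ Lf * ‖yc - ym‖ * ‖d‖ := by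
    have h1 : |⟪g, d⟫| ≤ ‖g‖ * ‖d‖ := abs_real_inner_le_norm g d
    have h2 := neg_abs_le ⟪g, d⟫
    have h3 := mul_le_mul_of_nonneg_right hgn (norm_nonneg d)
    linarith
  have hvd : ⟪v, d⟫ ≤ ‖v‖ * ‖d‖ := real_inner_le_norm v d
  have hX' : 0 ≤ ρ * ⟪d, e⟫ + ⟪v, d⟫ - ⟪wc, e⟫ - ⟪v, e⟫ - ρ⁻¹ * ⟪wc, v⟫ - ρ⁻¹ * ‖v‖ ^ 2 := by
    have e1 : yc + d - yc = d := by abel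
    have e2 : yc + d + e - (yc + d - ρ⁻¹ • v) = e + ρ⁻¹ • v := by abel
    rw [e1, e2] at hX
    simp only [inner_sub_left, inner_add_left, inner_add_right, real_inner_smul_left,
      real_inner_smul_right, real_inner_self_eq_norm_sq] at hX
    have e3 : ρ * (ρ⁻¹ * ⟪d, v⟫) = ⟪v, d⟫ := by
      rw [← mul_assoc, mul_inv_cancel₀ hρ0.ne', one_mul, real_inner_comm]
    linarith
  have e1 : yc + d - yc = d := by abel
  have e2 : yc + d + e - (yc + d) = e := by abel
  have e3 : yc + d - (yc + d + e) = -e := by abel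
  have e4 : yc - (yc + d + e) = -(d + e) := by abel
  have e5 : yc + d + e - yc = d + e := by abel
  rw [e1] at hdes
  rw [e2] at hcv hp1
  rw [e1, e2, e3, e4, e5, norm_neg, norm_neg, norm_add_sq_real d e, norm_add_sq_real wc v]
  simp only [inner_add_left, inner_add_right] at hp1 ⊢
  have hinv : 1 / (2 * ρ) = ρ⁻¹ / 2 := by field_simp
  rw [hinv]
  -- the scalar estimate
  have key : ⟪v, d⟫ - ρ⁻¹ / 2 * ‖v‖ ^ 2 ≤ (ρ - 2 * Lf) / 4 * ‖yc - ym‖ ^ 2 + ρ / 4 * ‖d‖ ^ 2 := by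
    have k1 : ⟪v, d⟫ ≤ 1 / 2 * (‖v‖ * ‖d‖) + 1 / 2 * (Lf * ‖yc - ym‖ * ‖d‖) := by linarith
    have k2 : 1 / 2 * (‖v‖ * ‖d‖) ≤ ρ⁻¹ / 2 * ‖v‖ ^ 2 + ρ / 8 * ‖d‖ ^ 2 := by
      have : ρ⁻¹ / 2 * ‖v‖ ^ 2 + ρ / 8 * ‖d‖ ^ 2 - 1 / 2 * (‖v‖ * ‖d‖)
          = ρ⁻¹ / 2 * (‖v‖ - ρ / 2 * ‖d‖) ^ 2 := by field_simp; ring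
      have h0 : 0 ≤ ρ⁻¹ / 2 * (‖v‖ - ρ / 2 * ‖d‖) ^ 2 := by positivity
      linarith
    have k3 : 1 / 2 * (Lf * ‖yc - ym‖ * ‖d‖)
        ≤ ρ⁻¹ / 2 * (Lf * ‖yc - ym‖) ^ 2 + ρ / 8 * ‖d‖ ^ 2 := by
      have : ρ⁻¹ / 2 * (Lf * ‖yc - ym‖) ^ 2 + ρ / 8 * ‖d‖ ^ 2 - 1 / 2 * (Lf * ‖yc - ym‖ * ‖d‖)
          = ρ⁻¹ / 2 * (Lf * ‖yc - ym‖ - ρ / 2 * ‖d‖) ^ 2 := by field_simp; ring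
      have h0 : 0 ≤ ρ⁻¹ / 2 * (Lf * ‖yc - ym‖ - ρ / 2 * ‖d‖) ^ 2 := by positivity
      linarith
    have k4 : ρ⁻¹ / 2 * Lf ^ 2 ≤ (ρ - 2 * Lf) / 4 := by
      have : (ρ - 2 * Lf) / 4 - ρ⁻¹ / 2 * Lf ^ 2
          = ρ⁻¹ / 4 * (ρ ^ 2 - 2 * Lf * ρ - 2 * Lf ^ 2) := by field_simp; ring
      have h0 : 0 ≤ ρ⁻¹ / 4 * (ρ ^ 2 - 2 * Lf * ρ - 2 * Lf ^ 2) :=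
        mul_nonneg (by positivity) (by linarith)
      linarith
    have k5 := mul_le_mul_of_nonneg_right k4 (sq_nonneg ‖yc - ym‖)
    linarith
  linarith
end

section
/- Assume the iterates (x^k, y^k, w^k), k ≥ 0, are generated by LP-ADMM steps with constant penalty parameter ρ > (√3 + 1)·L_f, and that a KKT point (x*, y*, w*) exists. Then the sequences (y^k) and (w^k) are bounded in ℝ^N. -/
open scoped RealInnerProductSpace

section helpers

variable {E : Type*} [NormedAddCommGroup E] [InnerProductSpace ℝ E]

lemma lp_quad (α β : ℝ) (h : ∀ t : ℝ, 0 < t → t ≤ 1 → 0 ≤ t * α + t ^ 2 * β) : 0 ≤ α := by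
  by_contra hα
  push Not at hα
  have hb : 0 < |β| + 1 + |α| := by positivity
  have ht : 0 < |α| / (|β| + 1 + |α|) := div_pos (abs_pos.mpr hα.ne) hb
  have h1 : |α| / (|β| + 1 + |α|) ≤ 1 := by
    rw [div_le_one hb]; have := abs_nonneg β; linarith
  have h2 := h _ ht h1
  set t := |α| / (|β| + 1 + |α|) with htd
  have h3 : t * (|β| + 1 + |α|) = |α| := by rw [htd]; field_simp
  rw [abs_of_neg hα] at h3
  have h4 : 0 ≤ α + t * β := by
    have : 0 ≤ t * (α + t * β) := by nlinarith
    exact nonneg_of_mul_nonneg_right this ht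
  have h5 : t * β ≤ t * |β| := mul_le_mul_of_nonneg_left (le_abs_self β) ht.le
  nlinarith

lemma lp_norm_add (u v : E) (t : ℝ) :
    ‖u + t • v‖ ^ 2 = ‖u‖ ^ 2 + 2 * t * ⟪u, v⟫ + t ^ 2 * ‖v‖ ^ 2 := by
  rw [norm_add_sq_real, inner_smul_right, norm_smul, mul_pow, Real.norm_eq_abs, sq_abs]
  ring

lemma lp_prox (P : E → ℝ) (hP : ConvexOn ℝ Set.univ P) (ρ : ℝ) (c z0 : E)
    (h : ∀ z, ρ / 2 * ‖z0 - c‖ ^ 2 + P z0 ≤ ρ / 2 * ‖z - c‖ ^ 2 + P z) (z : E) :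
    0 ≤ P z - P z0 + ρ * ⟪z0 - c, z - z0⟫ := by
  apply lp_quad _ (ρ / 2 * ‖z - z0‖ ^ 2)
  intro t ht ht1
  have h1 := h (z0 + t • (z - z0))
  have h2 := hP.2 (Set.mem_univ z0) (Set.mem_univ z) (sub_nonneg.mpr ht1) ht.le (by ring)
  have e : (1 - t) • z0 + t • z = z0 + t • (z - z0) := by module
  rw [e] at h2
  have e2 : z0 + t • (z - z0) - c = (z0 - c) + t • (z - z0) := by abel
  rw [e2, lp_norm_add] at h1
  simp only [smul_eq_mul] at h2
  nlinarith

lemma lp_proj {C : Set E} (hC : Convex ℝ C) (c z0 : E) (hz0 : z0 ∈ C)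
    (h : ∀ z ∈ C, ‖z0 - c‖ ^ 2 ≤ ‖z - c‖ ^ 2) (z : E) (hz : z ∈ C) :
    0 ≤ ⟪z0 - c, z - z0⟫ := by
  have : 0 ≤ 2 * ⟪z0 - c, z - z0⟫ := by
    apply lp_quad _ (‖z - z0‖ ^ 2)
    intro t ht ht1
    have h1 := h _ (hC hz0 hz (sub_nonneg.mpr ht1) ht.le (by ring))
    have e : (1 - t) • z0 + t • z - c = (z0 - c) + t • (z - z0) := by module
    rw [e, lp_norm_add] at h1
    nlinarith
  linarith

variable [CompleteSpace E]

lemma lp_line (f : E → ℝ) (f' : E → E) (hgrad : ∀ z, HasGradientAt f (f' z) z) (a v : E) (t : ℝ) :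
    HasDerivAt (fun s : ℝ => f (a + s • v)) ⟪f' (a + t • v), v⟫ t := by
  have h1 : HasDerivAt (fun s : ℝ => a + s • v) v t := by
    simpa using ((hasDerivAt_id t).smul_const v).const_add a
  have h2 := (hgrad (a + t • v)).hasFDerivAt.comp_hasDerivAt t h1
  exact h2.congr_deriv (by simp)

lemma lp_descent (f : E → ℝ) (f' : E → E) (hgrad : ∀ z, HasGradientAt f (f' z) z)
    (L : ℝ) (hlip : ∀ a b, ‖f' a - f' b‖ ≤ L * ‖a - b‖) (a v : E) :
    f (a + v) ≤ f a + ⟪f' a, v⟫ + L / 2 * ‖v‖ ^ 2 := by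
  have hd : ∀ t : ℝ, HasDerivAt (fun s : ℝ => f (a + s • v) - s * ⟪f' a, v⟫ - L / 2 * ‖v‖ ^ 2 * s ^ 2)
      (⟪f' (a + t • v), v⟫ - ⟪f' a, v⟫ - L / 2 * ‖v‖ ^ 2 * (2 * t)) t := by
    intro t
    have h1 := (lp_line f f' hgrad a v t).sub ((hasDerivAt_id t).mul_const ⟪f' a, v⟫)
    have h2 := h1.sub ((hasDerivAt_pow 2 t).const_mul (L / 2 * ‖v‖ ^ 2))
    exact h2.congr_deriv (by simp)
  have hanti := antitoneOn_of_deriv_nonpos (convex_Icc (0:ℝ) 1)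
    (fun t _ => (hd t).continuousAt.continuousWithinAt)
    (fun t _ => (hd t).differentiableAt.differentiableWithinAt) (by
      intro t ht
      rw [interior_Icc] at ht
      rw [(hd t).deriv, ← inner_sub_left]
      have h1 := real_inner_le_norm (f' (a + t • v) - f' a) v
      have h2 := hlip (a + t • v) a
      rw [add_sub_cancel_left, norm_smul, Real.norm_eq_abs, abs_of_pos ht.1] at h2
      have h3 := mul_le_mul_of_nonneg_right h2 (norm_nonneg v)
      nlinarith)
  have := hanti (Set.left_mem_Icc.mpr zero_le_one) (Set.right_mem_Icc.mpr zero_le_one) zero_le_one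
  simp at this
  linarith

lemma lp_first (f : E → ℝ) (hf : ConvexOn ℝ Set.univ f) (f' : E → E)
    (hgrad : ∀ z, HasGradientAt f (f' z) z)
    (L : ℝ) (hlip : ∀ a b, ‖f' a - f' b‖ ≤ L * ‖a - b‖) (a z : E) :
    f a + ⟪f' a, z - a⟫ ≤ f z := by
  have : 0 ≤ f z - f a - ⟪f' a, z - a⟫ := by
    apply lp_quad _ (3 * L / 2 * ‖z - a‖ ^ 2)
    intro t ht ht1
    have h2 := hf.2 (Set.mem_univ a) (Set.mem_univ z) (sub_nonneg.mpr ht1) ht.le (by ring)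
    have e : (1 - t) • a + t • z = a + t • (z - a) := by module
    rw [e] at h2
    simp only [smul_eq_mul] at h2
    have h1 := lp_descent f f' hgrad L hlip (a + t • (z - a)) (-(t • (z - a)))
    rw [add_neg_cancel_right, norm_neg, norm_smul, inner_neg_right, inner_smul_right, mul_pow,
      Real.norm_eq_abs, sq_abs] at h1
    have h3 := hlip (a + t • (z - a)) a
    rw [add_sub_cancel_left, norm_smul, Real.norm_eq_abs, abs_of_pos ht] at h3
    have h4 := neg_le_of_abs_le (abs_real_inner_le_norm (f' (a + t • (z - a)) - f' a) (z - a))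
    rw [inner_sub_left] at h4
    have h5 := mul_le_mul_of_nonneg_right h3 (norm_nonneg (z - a))
    have h6 : 0 ≤ t * (⟪f' (a + t • (z - a)), z - a⟫ - ⟪f' a, z - a⟫ + L * (t * ‖z - a‖ ^ 2)) := by
      apply mul_nonneg ht.le
      nlinarith
    nlinarith
  linarith

lemma lp_coco1 (f : E → ℝ) (hf : ConvexOn ℝ Set.univ f) (f' : E → E)
    (hgrad : ∀ z, HasGradientAt f (f' z) z)
    (L : ℝ) (hL : 0 < L) (hlip : ∀ a b, ‖f' a - f' b‖ ≤ L * ‖a - b‖) (a b : E) :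
    f a + ⟪f' a, b - a⟫ + ‖f' b - f' a‖ ^ 2 / (2 * L) ≤ f b := by
  set g := f' b - f' a with hg
  have h1 := lp_first f hf f' hgrad L hlip a (b + (-L⁻¹) • g)
  have h2 := lp_descent f f' hgrad L hlip b ((-L⁻¹) • g)
  have e : b + (-L⁻¹) • g - a = (b - a) + (-L⁻¹) • g := by abel
  rw [e, inner_add_right, inner_smul_right] at h1
  rw [inner_smul_right, norm_smul, mul_pow, Real.norm_eq_abs, sq_abs] at h2
  have h3 : ⟪f' b, g⟫ - ⟪f' a, g⟫ = ‖g‖ ^ 2 := by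
    rw [← inner_sub_left, ← hg, real_inner_self_eq_norm_sq]
  have h4 : L / 2 * ((-L⁻¹) ^ 2 * ‖g‖ ^ 2) = ‖g‖ ^ 2 / (2 * L) := by field_simp
  have h5 : L⁻¹ * (⟪f' b, g⟫ - ⟪f' a, g⟫) = 2 * (‖g‖ ^ 2 / (2 * L)) := by rw [h3]; field_simp
  linarith

lemma lp_coco (f : E → ℝ) (hf : ConvexOn ℝ Set.univ f) (f' : E → E)
    (hgrad : ∀ z, HasGradientAt f (f' z) z)
    (L : ℝ) (hL : 0 < L) (hlip : ∀ a b, ‖f' a - f' b‖ ≤ L * ‖a - b‖) (s y d : E) :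
    - (L / 4 * ‖d‖ ^ 2) ≤ ⟪f' y - f' s, y + d - s⟫ := by
  have h1 := lp_coco1 f hf f' hgrad L hL hlip s y
  have h2 := lp_coco1 f hf f' hgrad L hL hlip y s
  rw [norm_sub_rev (f' s)] at h2
  rw [← neg_sub y s, inner_neg_right] at h2
  have e : y + d - s = (y - s) + d := by abel
  rw [e, inner_add_right, inner_sub_left _ _ (y - s)]
  have h3 := neg_le_of_abs_le (abs_real_inner_le_norm (f' y - f' s) d)
  set G := ‖f' y - f' s‖
  have h4 : 0 ≤ G ^ 2 / L - G * ‖d‖ + L / 4 * ‖d‖ ^ 2 := by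
    have : G ^ 2 / L - G * ‖d‖ + L / 4 * ‖d‖ ^ 2 = (G - L / 2 * ‖d‖) ^ 2 / L := by
      field_simp; ring
    rw [this]; positivity
  have h5 : G ^ 2 / L = 2 * (G ^ 2 / (2 * L)) := by field_simp
  linarith

end helpers

/-- Boundedness of the LP-ADMM iterates (from the proof of Theorem 4.3(a)):
if `ρ > (√3 + 1)L_f` and a KKT point `(x*, y*, w*)` exists, then the sequences
`(y^k)` and `(w^k)` are bounded. -/
theorem lpadmm_iterates_bounded
    {n N : ℕ} (hn : 0 < n) (hN : 0 < N)
    (A : EuclideanSpace ℝ (Fin n) →L[ℝ] EuclideanSpace ℝ (Fin N))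
    (C : Set (EuclideanSpace ℝ (Fin n)))
    (hCne : C.Nonempty) (hCconv : Convex ℝ C) (hCclosed : IsClosed C)
    (P : EuclideanSpace ℝ (Fin N) → ℝ) (hP : ConvexOn ℝ Set.univ P)
    (f : EuclideanSpace ℝ (Fin N) → ℝ) (hf : ConvexOn ℝ Set.univ f)
    (f' : EuclideanSpace ℝ (Fin N) → EuclideanSpace ℝ (Fin N))
    (hgrad : ∀ z, HasGradientAt f (f' z) z)
    (Lf : ℝ) (hLf : 0 < Lf)
    (hlip : ∀ a b, ‖f' a - f' b‖ ≤ Lf * ‖a - b‖)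
    (ρ : ℝ) (hρ : (Real.sqrt 3 + 1) * Lf < ρ)
    (x : ℕ → EuclideanSpace ℝ (Fin n)) (y w : ℕ → EuclideanSpace ℝ (Fin N))
    (hx : ∀ k, x (k+1) ∈ C ∧
      IsMinOn (fun u => ‖A u - y k - ρ⁻¹ • w k‖ ^ 2) C (x (k+1)))
    (hy : ∀ k, IsMinOn
      (fun z => ρ / 2 * ‖z - (A (x (k+1)) - ρ⁻¹ • (w k + f' (y k)))‖ ^ 2 + P z)
      Set.univ (y (k+1)))
    (hw : ∀ k, w (k+1) = w k - ρ • (A (x (k+1)) - y (k+1)))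
    (xs : EuclideanSpace ℝ (Fin n)) (ys ws : EuclideanSpace ℝ (Fin N))
    (hxsC : xs ∈ C) (hAxs : A xs = ys)
    (hkkt_x : ∀ xx ∈ C, ⟪ws, A xx - A xs⟫ ≤ 0)
    (hkkt_y : ∀ z, P ys + ⟪-ws - f' ys, z - ys⟫ ≤ P z) :
    (∃ M : ℝ, ∀ k, ‖y k‖ ≤ M) ∧ (∃ M : ℝ, ∀ k, ‖w k‖ ≤ M) := by
  have hρ3 : 5 / 2 * Lf ≤ ρ := by
    have h3 : (3 / 2 : ℝ) ≤ Real.sqrt 3 := Real.le_sqrt_of_sq_le (by norm_num)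
    nlinarith
  have hρ0 : 0 < ρ := by linarith
  -- optimality of the y step
  have hsub : ∀ k z, P (y (k+1)) + ⟪-w (k+1) - f' (y k), z - y (k+1)⟫ ≤ P z := by
    intro k z
    have h1 := lp_prox P hP ρ _ (y (k+1)) (fun z => isMinOn_univ_iff.mp (hy k) z) z
    have e : -w (k+1) - f' (y k)
        = -(ρ • (y (k+1) - (A (x (k+1)) - ρ⁻¹ • (w k + f' (y k))))) := by
      rw [hw k]
      have : ρ • ρ⁻¹ • (w k + f' (y k)) = w k + f' (y k) := smul_inv_smul₀ hρ0.ne' _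
      simp only [smul_sub, this]
      abel
    rw [e, inner_neg_left, real_inner_smul_left]
    linarith
  -- optimality of the x step
  have hxopt : ∀ k, ρ * ⟪y (k+1) - y k, A (x (k+1)) - ys⟫
      - ⟪w (k+1) - ws, A (x (k+1)) - ys⟫ ≤ 0 := by
    intro k
    have h1 := lp_proj (hCconv.linear_image A.toLinearMap) (y k + ρ⁻¹ • w k) (A (x (k+1)))
      ⟨_, (hx k).1, rfl⟩ (by
        rintro _ ⟨u, hu, rfl⟩
        have := isMinOn_iff.mp (hx k).2 u hu
        simpa [sub_sub] using this) ys ⟨xs, hxsC, hAxs⟩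
    have h2 := hkkt_x _ (hx k).1
    rw [hAxs] at h2
    have e : ρ • (y (k+1) - y k) - (w (k+1) - ws)
        = ρ • (A (x (k+1)) - (y k + ρ⁻¹ • w k)) + ws := by
      rw [hw k]
      have : ρ • ρ⁻¹ • w k = w k := smul_inv_smul₀ hρ0.ne' _
      simp only [smul_sub, smul_add, this]
      abel
    rw [← real_inner_smul_left, ← inner_sub_left, e, inner_add_left, real_inner_smul_left]
    rw [← neg_sub (A (x (k+1))) ys, inner_neg_right] at h1
    nlinarith
  have hstep : ∀ k,
      ρ / 2 * ‖y (k+2) - ys‖ ^ 2 + 1 / (2 * ρ) * ‖w (k+2) - ws‖ ^ 2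
        + Lf / 2 * ‖y (k+2) - y (k+1)‖ ^ 2 ≤
      ρ / 2 * ‖y (k+1) - ys‖ ^ 2 + 1 / (2 * ρ) * ‖w (k+1) - ws‖ ^ 2
        + Lf / 2 * ‖y (k+1) - y k‖ ^ 2 := by
    intro k
    have h1 := hxopt (k+1)
    have h2 := hsub (k+1) ys
    have h3 := hkkt_y (y (k+2))
    have h4 := hsub (k+1) (y (k+1))
    have h5 := hsub k (y (k+2))
    have h6 := lp_coco f hf f' hgrad Lf hLf hlip ys (y (k+1)) (y (k+2) - y (k+1))
    have h7 := hlip (y (k+1)) (y k)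
    have h8 := neg_le_of_abs_le
      (abs_real_inner_le_norm (f' (y (k+1)) - f' (y k)) (y (k+2) - y (k+1)))
    have h9 := mul_le_mul_of_nonneg_right h7 (norm_nonneg (y (k+2) - y (k+1)))
    have ea : A (x (k+2)) - ys = (y (k+2) - ys) - ρ⁻¹ • (w (k+2) - w (k+1)) := by
      have : ρ⁻¹ • (w (k+2) - w (k+1)) = y (k+2) - A (x (k+2)) := by
        rw [hw (k+1), sub_sub_cancel_left, ← smul_neg, inv_smul_smul₀ hρ0.ne']
        abel
      rw [this]; abel
    simp only [show k + 1 + 1 = k + 2 from rfl] at h1 h2 h4 h5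
    rw [ea] at h1
    -- abbreviations
    obtain ⟨d, hd⟩ : ∃ d, d = y (k+2) - y (k+1) := ⟨_, rfl⟩
    obtain ⟨δ, hδ⟩ : ∃ δ, δ = w (k+2) - w (k+1) := ⟨_, rfl⟩
    obtain ⟨Y, hY⟩ : ∃ Y, Y = y (k+2) - ys := ⟨_, rfl⟩
    obtain ⟨W, hW⟩ : ∃ W, W = w (k+2) - ws := ⟨_, rfl⟩
    have eY : y (k+1) - ys = Y - d := by rw [hY, hd]; abel
    have eW : w (k+1) - ws = W - δ := by rw [hW, hδ]; abel
    rw [eY, eW, norm_sub_sq_real Y d, norm_sub_sq_real W δ]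
    have e6 : y (k+1) + (y (k+2) - y (k+1)) - ys = Y := by rw [hY]; abel
    rw [e6] at h6
    rw [← neg_sub (y (k+2)) ys] at h2
    rw [← neg_sub (y (k+2)) (y (k+1))] at h4
    rw [← hd] at h1 h4 h5 h6 h8 h9 ⊢
    rw [← hδ, ← hY, ← hW] at h1
    rw [← hY] at h2 h3 ⊢
    rw [← hW]
    -- monotonicity facts
    have m1 : ⟪W, Y⟫ + ⟪f' (y (k+1)) - f' ys, Y⟫ ≤ 0 := by
      rw [hW]
      simp only [inner_sub_left, inner_neg_left, inner_neg_right] at h2 h3 ⊢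
      linarith
    have m2 : ⟪d, δ⟫ + ⟪f' (y (k+1)) - f' (y k), d⟫ ≤ 0 := by
      rw [real_inner_comm, hδ]
      simp only [inner_sub_left, inner_neg_left, inner_neg_right] at h4 h5 ⊢
      linarith
    have m3 : ρ * ⟪Y, d⟫ - ⟪d, δ⟫ - ⟪W, Y⟫ + ρ⁻¹ * ⟪W, δ⟫ ≤ 0 := by
      simp only [inner_sub_right, real_inner_smul_right] at h1
      rw [real_inner_comm d Y] at *
      have : ρ * (ρ⁻¹ * ⟪d, δ⟫) = ⟪d, δ⟫ := by field_simp
      linarith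
    have hi : 1 / (2 * ρ) = ρ⁻¹ / 2 := by field_simp
    have hi0 : 0 ≤ ρ⁻¹ * ‖δ‖ ^ 2 := by positivity
    have q := mul_nonneg hLf.le (sq_nonneg (‖y (k+1) - y k‖ - ‖d‖))
    have q2 := mul_le_mul_of_nonneg_right hρ3 (sq_nonneg ‖d‖)
    rw [hi]
    nlinarith
  obtain ⟨V, hV⟩ : ∃ V : ℝ, V = ρ / 2 * ‖y 1 - ys‖ ^ 2 + 1 / (2 * ρ) * ‖w 1 - ws‖ ^ 2
        + Lf / 2 * ‖y 1 - y 0‖ ^ 2 := ⟨_, rfl⟩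
  have hall : ∀ k, ρ / 2 * ‖y (k+1) - ys‖ ^ 2 + 1 / (2 * ρ) * ‖w (k+1) - ws‖ ^ 2
        + Lf / 2 * ‖y (k+1) - y k‖ ^ 2 ≤ V := by
    intro k
    induction k with
    | zero => rw [hV]
    | succ k ih => exact (hstep k).trans ih
  have bd : ∀ (c : ℝ) (u : ℕ → EuclideanSpace ℝ (Fin N)) (s : EuclideanSpace ℝ (Fin N)), 0 < c →
      (∀ k, c * ‖u (k+1) - s‖ ^ 2 ≤ V) → ∃ M : ℝ, ∀ k, ‖u k‖ ≤ M := by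
    intro c u s hc h
    refine ⟨max ‖u 0‖ (Real.sqrt (V / c) + ‖s‖), ?_⟩
    rintro (_ | k)
    · exact le_max_left _ _
    · refine le_trans ?_ (le_max_right _ _)
      have h1 : ‖u (k+1) - s‖ ≤ Real.sqrt (V / c) := by
        apply Real.le_sqrt_of_sq_le
        rw [le_div_iff₀ hc]
        linarith [h k]
      have h2 := norm_add_le (u (k+1) - s) s
      rw [sub_add_cancel] at h2
      linarith
  refine ⟨bd (ρ / 2) y ys (by positivity) fun k => ?_, bd (1 / (2 * ρ)) w ws (by positivity) fun k => ?_⟩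
  · have h1 : 0 ≤ 1 / (2 * ρ) * ‖w (k+1) - ws‖ ^ 2 := by positivity
    have h2 : 0 ≤ Lf / 2 * ‖y (k+1) - y k‖ ^ 2 := by positivity
    linarith [hall k]
  · have h1 : 0 ≤ ρ / 2 * ‖y (k+1) - ys‖ ^ 2 := by positivity
    have h2 : 0 ≤ Lf / 2 * ‖y (k+1) - y k‖ ^ 2 := by positivity
    linarith [hall k]
end

section
/- Assume the iterates (x^k, y^k, w^k), k ≥ 0, are generated by LP-ADMM steps with constant penalty parameter ρ > (√3 + 1)·L_f, and that a KKT point (x*, y*, w*) exists. Then ∑_{k=0}^∞ ‖y^{k+1} − y^k‖² < ∞; moreover, as k → ∞, ‖y^{k+1} − y^k‖ → 0, ‖Ax^{k+1} − y^{k+1}‖ → 0, and ‖w^{k+1} − w^k‖ → 0. -/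
open scoped RealInnerProductSpace
open Filter

section LPADMMHelpers

variable {E : Type*} [NormedAddCommGroup E] [InnerProductSpace ℝ E]

theorem lpadmm_aux_scalar (a b : ℝ) (h : ∀ t : ℝ, 0 < t → t ≤ 1 → 0 ≤ a + t * b) : 0 ≤ a := by
  by_contra hneg
  push Not at hneg
  have hb : 0 < b := by
    have := h 1 one_pos le_rfl
    linarith
  by_cases hc : -a / (2 * b) ≤ 1
  · have h1 := h (-a / (2 * b)) (by apply div_pos <;> linarith) hc
    have h2 : -a / (2 * b) * b = -a / 2 := by field_simp
    rw [h2] at h1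
    linarith
  · push Not at hc
    rw [lt_div_iff₀ (by linarith)] at hc
    have := h 1 one_pos le_rfl
    linarith

theorem lpadmm_aux_norm (p q : E) (t : ℝ) :
    ‖p + t • q‖ ^ 2 = ‖p‖ ^ 2 + t * (2 * ⟪p, q⟫) + t ^ 2 * ‖q‖ ^ 2 := by
  rw [norm_add_sq_real, real_inner_smul_right, norm_smul, mul_pow, Real.norm_eq_abs, sq_abs]
  ring

/-- Variational inequality for a proximal step. -/
theorem lpadmm_aux_prox (P : E → ℝ) (hP : ConvexOn ℝ Set.univ P) (ρ : ℝ) (c v : E)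
    (hv : IsMinOn (fun z => ρ / 2 * ‖z - c‖ ^ 2 + P z) Set.univ v) (z : E) :
    P v ≤ P z + ρ * ⟪v - c, z - v⟫ := by
  have key : 0 ≤ P z + ρ * ⟪v - c, z - v⟫ - P v := by
    apply lpadmm_aux_scalar _ (ρ / 2 * ‖z - v‖ ^ 2)
    intro t ht ht1
    have h1 := hv (Set.mem_univ (v + t • (z - v)))
    simp only [Set.mem_ofPred_eq] at h1
    have h2 : v + t • (z - v) - c = (v - c) + t • (z - v) := by abel
    rw [h2, lpadmm_aux_norm] at h1
    have h3 := hP.2 (Set.mem_univ v) (Set.mem_univ z) (by linarith : (0:ℝ) ≤ 1 - t) ht.le (by ring)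
    have h4 : (1 - t) • v + t • z = v + t • (z - v) := by module
    rw [h4] at h3
    simp only [smul_eq_mul] at h3
    have h5 : 0 ≤ t * (P z + ρ * ⟪v - c, z - v⟫ - P v + t * (ρ / 2 * ‖z - v‖ ^ 2)) := by
      nlinarith
    exact nonneg_of_mul_nonneg_right h5 ht
  linarith

/-- Gradient inequality for convex functions and the descent lemma. -/
theorem lpadmm_aux_line [CompleteSpace E] (f : E → ℝ) (f' : E → E)
    (hgrad : ∀ z, HasGradientAt f (f' z) z) (a d : E) (t : ℝ) :
    HasDerivAt (fun s : ℝ => f (a + s • d)) ⟪f' (a + t • d), d⟫ t := by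
  have h1 : HasDerivAt (fun s : ℝ => a + s • d) d t := by
    simpa using ((hasDerivAt_id t).smul_const d).const_add a
  have h2 := (hgrad (a + t • d)).hasFDerivAt
  have h3 := h2.comp_hasDerivAt t h1
  have h4 : (InnerProductSpace.toDual ℝ E) (f' (a + t • d)) d = ⟪f' (a + t • d), d⟫ := by simp
  rw [h4] at h3
  exact h3

theorem lpadmm_aux_grad [CompleteSpace E] (f : E → ℝ) (hf : ConvexOn ℝ Set.univ f) (f' : E → E)
    (hgrad : ∀ z, HasGradientAt f (f' z) z) (a b : E) :
    f a + ⟪f' a, b - a⟫ ≤ f b := by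
  have hd := lpadmm_aux_line f f' hgrad a (b - a) 0
  simp only [zero_smul, add_zero] at hd
  have hc : ConvexOn ℝ Set.univ (fun s : ℝ => f (a + s • (b - a))) := by
    refine ⟨convex_univ, ?_⟩
    intro s _ t _ α β hα hβ hαβ
    have := hf.2 (Set.mem_univ (a + s • (b - a))) (Set.mem_univ (a + t • (b - a))) hα hβ hαβ
    refine le_trans (le_of_eq ?_) this
    have hα' : α = 1 - β := by linarith
    subst hα'
    simp only [smul_eq_mul]
    congr 1
    module
  have := hc.le_slope_of_hasDerivAt (Set.mem_univ 0) (Set.mem_univ 1) one_pos hd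
  simp [slope_def_field] at this
  linarith

theorem lpadmm_aux_descent [CompleteSpace E] (f : E → ℝ) (f' : E → E)
    (hgrad : ∀ z, HasGradientAt f (f' z) z) (L : ℝ)
    (hlip : ∀ a b, ‖f' a - f' b‖ ≤ L * ‖a - b‖) (a d : E) :
    f (a + d) ≤ f a + ⟪f' a, d⟫ + L / 2 * ‖d‖ ^ 2 := by
  have hD : ∀ t : ℝ, HasDerivAt
      (fun s : ℝ => f (a + s • d) - s * ⟪f' a, d⟫ - s ^ 2 * (L / 2 * ‖d‖ ^ 2))
      (⟪f' (a + t • d), d⟫ - 1 * ⟪f' a, d⟫ - (2 * t) * (L / 2 * ‖d‖ ^ 2)) t := by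
    intro t
    refine ((lpadmm_aux_line f f' hgrad a d t).sub ((hasDerivAt_id t).mul_const _)).sub ?_
    have := (hasDerivAt_pow 2 t).mul_const (L / 2 * ‖d‖ ^ 2)
    simpa using this
  have hanti : AntitoneOn
      (fun s : ℝ => f (a + s • d) - s * ⟪f' a, d⟫ - s ^ 2 * (L / 2 * ‖d‖ ^ 2))
      (Set.Icc 0 1) := by
    apply antitoneOn_of_deriv_nonpos (convex_Icc 0 1)
    · exact fun t _ => (hD t).continuousAt.continuousWithinAt
    · exact fun t _ => (hD t).differentiableAt.differentiableWithinAt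
    · intro t ht
      rw [interior_Icc] at ht
      rw [(hD t).deriv]
      have h1 := real_inner_le_norm (f' (a + t • d) - f' a) d
      have h2 := hlip (a + t • d) a
      rw [add_sub_cancel_left, norm_smul, Real.norm_eq_abs, abs_of_pos ht.1] at h2
      rw [inner_sub_left] at h1
      have h3 := mul_le_mul_of_nonneg_right h2 (norm_nonneg d)
      nlinarith
  have := hanti (Set.left_mem_Icc.2 zero_le_one) (Set.right_mem_Icc.2 zero_le_one) zero_le_one
  simp at this
  linarith

theorem lpadmm_aux_strong [CompleteSpace E] (f : E → ℝ) (hf : ConvexOn ℝ Set.univ f) (f' : E → E)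
    (hgrad : ∀ z, HasGradientAt f (f' z) z) (L : ℝ) (hL : 0 < L)
    (hlip : ∀ a b, ‖f' a - f' b‖ ≤ L * ‖a - b‖) (a b : E) :
    f b + ⟪f' b, a - b⟫ + 1 / (2 * L) * ‖f' a - f' b‖ ^ 2 ≤ f a := by
  have h1 := lpadmm_aux_descent f f' hgrad L hlip a (-(L⁻¹ • (f' a - f' b)))
  have h2 := lpadmm_aux_grad f hf f' hgrad b (a + -(L⁻¹ • (f' a - f' b)))
  have h3 : a + -(L⁻¹ • (f' a - f' b)) - b = (a - b) + -(L⁻¹ • (f' a - f' b)) := by abel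
  rw [h3, inner_add_right] at h2
  rw [norm_neg, norm_smul, mul_pow, Real.norm_eq_abs, sq_abs] at h1
  simp only [inner_neg_right, real_inner_smul_right] at h1 h2
  have h4 : ⟪f' a, f' a - f' b⟫ - ⟪f' b, f' a - f' b⟫ = ‖f' a - f' b‖ ^ 2 := by
    rw [← inner_sub_left, real_inner_self_eq_norm_sq]
  have h5 : L / 2 * (L⁻¹ ^ 2 * ‖f' a - f' b‖ ^ 2) = L⁻¹ / 2 * ‖f' a - f' b‖ ^ 2 := by
    field_simp
  have h6 : 1 / (2 * L) = L⁻¹ / 2 := by field_simp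
  rw [h5] at h1
  rw [h6]
  have h7 : L⁻¹ * ⟪f' a, f' a - f' b⟫ - L⁻¹ * ⟪f' b, f' a - f' b⟫ = L⁻¹ * ‖f' a - f' b‖ ^ 2 := by
    rw [← h4]; ring
  linarith

theorem lpadmm_aux_three [CompleteSpace E] (f : E → ℝ) (hf : ConvexOn ℝ Set.univ f) (f' : E → E)
    (hgrad : ∀ z, HasGradientAt f (f' z) z) (L : ℝ) (hL : 0 < L)
    (hlip : ∀ a b, ‖f' a - f' b‖ ≤ L * ‖a - b‖) (a b c : E) :
    -(L / 4) * ‖c - a‖ ^ 2 ≤ ⟪f' a - f' b, c - b⟫ := by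
  have h1 := lpadmm_aux_strong f hf f' hgrad L hL hlip a b
  have h2 := lpadmm_aux_strong f hf f' hgrad L hL hlip b a
  have h3 : c - b = (c - a) + (a - b) := by abel
  have h4 : b - a = -(a - b) := by abel
  rw [norm_sub_rev, h4, inner_neg_right] at h2
  have h5 : L⁻¹ * ‖f' a - f' b‖ ^ 2 ≤ ⟪f' a - f' b, a - b⟫ := by
    rw [inner_sub_left]
    have h6 : 1 / (2 * L) = L⁻¹ / 2 := by field_simp
    rw [h6] at h1 h2
    linarith
  rw [h3, inner_add_right]
  have h7 := neg_le_of_abs_le (abs_real_inner_le_norm (f' a - f' b) (c - a))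
  have h8 : ‖f' a - f' b‖ * ‖c - a‖ ≤ L⁻¹ * ‖f' a - f' b‖ ^ 2 + L / 4 * ‖c - a‖ ^ 2 := by
    have h9 : L⁻¹ * ‖f' a - f' b‖ ^ 2 + L / 4 * ‖c - a‖ ^ 2 - ‖f' a - f' b‖ * ‖c - a‖
        = L⁻¹ * (‖f' a - f' b‖ - L / 2 * ‖c - a‖) ^ 2 := by
      field_simp
      ring
    have : 0 ≤ L⁻¹ * (‖f' a - f' b‖ - L / 2 * ‖c - a‖) ^ 2 := by positivity
    linarith
  linarith

/-- The algebraic combination: `Y, Y1` and `W, W1` are errors of consecutive iterates. -/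
theorem lpadmm_aux_comb (ρ : ℝ) (hρ : 0 < ρ) (Y Y1 W W1 : E) (g : ℝ)
    (hx : ⟪-W1 + ρ • (Y1 - Y), Y1 + ρ⁻¹ • (W - W1)⟫ ≤ 0)
    (hy : g ≤ -⟪W1, Y1⟫) :
    1 / (2 * ρ) * ‖W1‖ ^ 2 + ρ / 2 * ‖Y1‖ ^ 2 + 1 / (2 * ρ) * ‖W1 - W‖ ^ 2
      + ρ / 2 * ‖Y1 - Y‖ ^ 2 + ⟪W - W1, Y1 - Y⟫ + g
      ≤ 1 / (2 * ρ) * ‖W‖ ^ 2 + ρ / 2 * ‖Y‖ ^ 2 := by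
  simp only [inner_add_left, inner_add_right, inner_sub_left, inner_sub_right, inner_neg_left,
    real_inner_smul_left, real_inner_smul_right, ← real_inner_self_eq_norm_sq] at *
  have c1 := real_inner_comm Y Y1
  have c2 := real_inner_comm W W1
  have c3 := real_inner_comm Y1 W
  have c4 := real_inner_comm Y1 W1
  have c5 := real_inner_comm Y W
  have c6 := real_inner_comm Y W1
  have h1 : 1 / (2 * ρ) = ρ⁻¹ / 2 := by field_simp
  have h2 : ∀ r : ℝ, ρ * (ρ⁻¹ * r) = r := fun r => mul_inv_cancel_left₀ hρ.ne' r
  have h3 : ∀ r : ℝ, ρ⁻¹ * (ρ * r) = r := fun r => inv_mul_cancel_left₀ hρ.ne' r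
  rw [h1]
  simp only [← c1, ← c2, ← c3, ← c4, ← c5, ← c6] at *
  simp only [mul_add, mul_sub, mul_neg, h2, h3] at *
  linarith

theorem lpadmm_aux_summable (Φ a : ℕ → ℝ) (hΦ : ∀ k, 0 ≤ Φ k) (ha : ∀ k, 0 ≤ a k)
    (h : ∀ k, Φ (k + 1) + a k ≤ Φ k) : Summable a := by
  apply summable_of_sum_range_le (c := Φ 0) ha
  intro m
  have : ∀ m, ∑ i ∈ Finset.range m, a i + Φ m ≤ Φ 0 := by
    intro m
    induction m with
    | zero => simp
    | succ m ih =>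
      rw [Finset.sum_range_succ]
      linarith [h m]
  linarith [this m, hΦ m]

end LPADMMHelpers

/-- Summability and vanishing differences of LP-ADMM iterates (from the proofs
of Proposition 4.1(c) and Theorem 4.3(a)): if `ρ > (√3 + 1)L_f` and a KKT point
exists, then `∑ₖ ‖y^{k+1} − y^k‖² < ∞` and `‖y^{k+1} − y^k‖ → 0`,
`‖Ax^{k+1} − y^{k+1}‖ → 0`, `‖w^{k+1} − w^k‖ → 0`. -/
theorem lpadmm_successive_differences_vanish
    {n N : ℕ} (hn : 0 < n) (hN : 0 < N)
    (A : EuclideanSpace ℝ (Fin n) →L[ℝ] EuclideanSpace ℝ (Fin N))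
    (C : Set (EuclideanSpace ℝ (Fin n)))
    (hCne : C.Nonempty) (hCconv : Convex ℝ C) (hCclosed : IsClosed C)
    (P : EuclideanSpace ℝ (Fin N) → ℝ) (hP : ConvexOn ℝ Set.univ P)
    (f : EuclideanSpace ℝ (Fin N) → ℝ) (hf : ConvexOn ℝ Set.univ f)
    (f' : EuclideanSpace ℝ (Fin N) → EuclideanSpace ℝ (Fin N))
    (hgrad : ∀ z, HasGradientAt f (f' z) z)
    (Lf : ℝ) (hLf : 0 < Lf)
    (hlip : ∀ a b, ‖f' a - f' b‖ ≤ Lf * ‖a - b‖)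
    (ρ : ℝ) (hρ : (Real.sqrt 3 + 1) * Lf < ρ)
    (x : ℕ → EuclideanSpace ℝ (Fin n)) (y w : ℕ → EuclideanSpace ℝ (Fin N))
    (hx : ∀ k, x (k+1) ∈ C ∧
      IsMinOn (fun u => ‖A u - y k - ρ⁻¹ • w k‖ ^ 2) C (x (k+1)))
    (hy : ∀ k, IsMinOn
      (fun z => ρ / 2 * ‖z - (A (x (k+1)) - ρ⁻¹ • (w k + f' (y k)))‖ ^ 2 + P z)
      Set.univ (y (k+1)))
    (hw : ∀ k, w (k+1) = w k - ρ • (A (x (k+1)) - y (k+1)))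
    (xs : EuclideanSpace ℝ (Fin n)) (ys ws : EuclideanSpace ℝ (Fin N))
    (hxsC : xs ∈ C) (hAxs : A xs = ys)
    (hkkt_x : ∀ xx ∈ C, ⟪ws, A xx - A xs⟫ ≤ 0)
    (hkkt_y : ∀ z, P ys + ⟪-ws - f' ys, z - ys⟫ ≤ P z) :
    Summable (fun k => ‖y (k+1) - y k‖ ^ 2) ∧
      Tendsto (fun k => ‖y (k+1) - y k‖) atTop (nhds 0) ∧
      Tendsto (fun k => ‖A (x (k+1)) - y (k+1)‖) atTop (nhds 0) ∧
      Tendsto (fun k => ‖w (k+1) - w k‖) atTop (nhds 0) := by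
  have hsqrt : (3:ℝ) / 2 < Real.sqrt 3 := by
    rw [Real.lt_sqrt] <;> norm_num
  have hρL : 5 / 2 * Lf < ρ := by nlinarith
  have hρ0 : 0 < ρ := by linarith
  -- dual update in residual form
  have hAx : ∀ k, A (x (k+1)) = y (k+1) + ρ⁻¹ • (w k - w (k+1)) := by
    intro k
    rw [hw k, sub_sub_cancel, smul_smul, inv_mul_cancel₀ hρ0.ne', one_smul]
    abel
  -- optimality of the proximal step
  have hopt : ∀ k z, P (y (k+1)) + ⟪-w (k+1) - f' (y k), z - y (k+1)⟫ ≤ P z := by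
    intro k z
    have h := lpadmm_aux_prox P hP ρ _ _ (hy k) z
    rw [← real_inner_smul_left] at h
    have h2 : ρ • (y (k+1) - (A (x (k+1)) - ρ⁻¹ • (w k + f' (y k))))
        = -(-w (k+1) - f' (y k)) := by
      rw [hw k, smul_sub, smul_sub ρ (A (x (k+1))), smul_smul, mul_inv_cancel₀ hρ0.ne', one_smul]
      module
    rw [h2, inner_neg_left] at h
    linarith
  -- optimality of the x step
  have hxopt : ∀ k, ⟪-(w (k+1) - ws) + ρ • ((y (k+1) - ys) - (y k - ys)),
      (y (k+1) - ys) + ρ⁻¹ • ((w k - ws) - (w (k+1) - ws))⟫ ≤ 0 := by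
    intro k
    have hk := hx k
    have h1 : 0 ≤ 2 * ⟪A (x (k+1)) - y k - ρ⁻¹ • w k, A xs - A (x (k+1))⟫ := by
      apply lpadmm_aux_scalar _ (‖A xs - A (x (k+1))‖ ^ 2)
      intro t ht ht1
      have hmem : x (k+1) + t • (xs - x (k+1)) ∈ C :=
        hCconv.add_smul_sub_mem hk.1 hxsC ⟨ht.le, ht1⟩
      have h1 := hk.2 hmem
      simp only [Set.mem_ofPred_eq] at h1
      have h2 : A (x (k+1) + t • (xs - x (k+1))) - y k - ρ⁻¹ • w k
          = (A (x (k+1)) - y k - ρ⁻¹ • w k) + t • (A xs - A (x (k+1))) := by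
        simp only [map_add, map_smul, map_sub]
        abel
      rw [h2, lpadmm_aux_norm] at h1
      have h5 : 0 ≤ t * (2 * ⟪A (x (k+1)) - y k - ρ⁻¹ • w k, A xs - A (x (k+1))⟫
          + t * ‖A xs - A (x (k+1))‖ ^ 2) := by nlinarith
      exact nonneg_of_mul_nonneg_right h5 ht
    have h2 := hkkt_x _ hk.1
    have h3 : (y (k+1) - ys) + ρ⁻¹ • ((w k - ws) - (w (k+1) - ws)) = A (x (k+1)) - A xs := by
      rw [hAx k, hAxs]
      module
    have h4 : -(w (k+1) - ws) + ρ • ((y (k+1) - ys) - (y k - ys))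
        = ρ • (A (x (k+1)) - y k - ρ⁻¹ • w k) + ws := by
      rw [smul_sub ρ (A (x (k+1)) - y k), smul_smul, mul_inv_cancel₀ hρ0.ne', one_smul, hw k]
      module
    rw [h3, h4, inner_add_left, real_inner_smul_left]
    rw [← neg_sub (A (x (k+1))) (A xs), inner_neg_right] at h1
    nlinarith
  have hyopt : ∀ k, ⟪f' (y k) - f' ys, y (k+1) - ys⟫ ≤ -⟪w (k+1) - ws, y (k+1) - ys⟫ := by
    intro k
    have h1 := hopt k ys
    have h2 := hkkt_y (y (k+1))
    rw [← neg_sub (y (k+1)) ys, inner_neg_right] at h1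
    simp only [inner_sub_left, inner_neg_left] at *
    linarith
  have hcross : ∀ k, -(Lf / 2) * (‖y (k+1) - y k‖ ^ 2 + ‖y (k+2) - y (k+1)‖ ^ 2)
      ≤ ⟪w (k+1) - w (k+2), y (k+2) - y (k+1)⟫ := by
    intro k
    have h1 := hopt k (y (k+2))
    have h2 := hopt (k+1) (y (k+1))
    simp only [add_assoc, Nat.reduceAdd] at h2
    rw [← neg_sub (y (k+2)) (y (k+1)), inner_neg_right] at h2
    have h3 := neg_le_of_abs_le (abs_real_inner_le_norm (f' (y (k+1)) - f' (y k))
      (y (k+2) - y (k+1)))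
    have h4 := mul_le_mul_of_nonneg_right (hlip (y (k+1)) (y k)) (norm_nonneg (y (k+2) - y (k+1)))
    have h5 : ⟪f' (y (k+1)) - f' (y k), y (k+2) - y (k+1)⟫
        ≤ ⟪w (k+1) - w (k+2), y (k+2) - y (k+1)⟫ := by
      rw [inner_sub_left] at h1 h2 ⊢
      rw [inner_sub_left]
      rw [inner_neg_left] at h1 h2
      linarith
    nlinarith [mul_nonneg hLf.le (sq_nonneg (‖y (k+1) - y k‖ - ‖y (k+2) - y (k+1)‖))]
  have hsum := lpadmm_aux_summable
    (fun k => 1 / (2 * ρ) * ‖w (k+1) - ws‖ ^ 2 + ρ / 2 * ‖y (k+1) - ys‖ ^ 2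
      + Lf / 2 * ‖y (k+1) - y k‖ ^ 2)
    (fun k => 1 / (2 * ρ) * ‖w (k+2) - w (k+1)‖ ^ 2
      + (ρ / 2 - 5 / 4 * Lf) * ‖y (k+2) - y (k+1)‖ ^ 2)
    (fun k => by positivity)
    (fun k => by
      have : 0 < ρ / 2 - 5 / 4 * Lf := by linarith
      positivity)
    (fun k => by
      have h1 := lpadmm_aux_comb ρ hρ0 _ _ _ _ _ (hxopt (k+1)) (hyopt (k+1))
      simp only [add_assoc, Nat.reduceAdd, sub_sub_sub_cancel_right] at h1 ⊢
      have h2 := hcross k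
      have h3 := lpadmm_aux_three f hf f' hgrad Lf hLf hlip (y (k+1)) ys (y (k+2))
      linarith)
  have hc : 0 < ρ / 2 - 5 / 4 * Lf := by linarith
  have hsy : Summable (fun k => ‖y (k+1) - y k‖ ^ 2) := by
    rw [← summable_nat_add_iff 1]
    refine Summable.of_nonneg_of_le (fun k => by positivity) (fun k => ?_)
      (hsum.mul_left (ρ / 2 - 5 / 4 * Lf)⁻¹)
    rw [inv_mul_eq_div, le_div_iff₀ hc]
    have : 0 ≤ 1 / (2 * ρ) * ‖w (k+2) - w (k+1)‖ ^ 2 := by positivity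
    simp only [add_assoc, Nat.reduceAdd]
    linarith
  have hsw : Summable (fun k => ‖w (k+1) - w k‖ ^ 2) := by
    rw [← summable_nat_add_iff 1]
    refine Summable.of_nonneg_of_le (fun k => by positivity) (fun k => ?_)
      (hsum.mul_left (2 * ρ))
    have h1 : 0 ≤ 2 * ρ * ((ρ / 2 - 5 / 4 * Lf) * ‖y (k+2) - y (k+1)‖ ^ 2) := by positivity
    have h2 : 2 * ρ * (1 / (2 * ρ) * ‖w (k+2) - w (k+1)‖ ^ 2) = ‖w (k+2) - w (k+1)‖ ^ 2 := by
      field_simp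
    simp only [add_assoc, Nat.reduceAdd]
    linarith
  have hroot : ∀ u : ℕ → ℝ, (∀ k, 0 ≤ u k) → Summable (fun k => u k ^ 2) →
      Tendsto u atTop (nhds 0) := by
    intro u hu hs
    have h := (Real.continuous_sqrt.tendsto 0).comp hs.tendsto_atTop_zero
    rw [Real.sqrt_zero] at h
    refine h.congr (fun k => ?_)
    exact Real.sqrt_sq (hu k)
  have htw := hroot _ (fun k => norm_nonneg (w (k+1) - w k)) hsw
  refine ⟨hsy, hroot _ (fun k => norm_nonneg _) hsy, ?_, htw⟩
  have h := htw.const_mul ρ⁻¹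
  rw [mul_zero] at h
  refine h.congr (fun k => ?_)
  rw [hAx k, add_sub_cancel_left, norm_smul, norm_sub_rev, Real.norm_eq_abs,
    abs_of_pos (inv_pos.2 hρ0)]
end

section
/- Assume the iterates (x^k, y^k, w^k), k ≥ 0, are generated by LP-ADMM steps with constant penalty parameter ρ > (√3 + 1)·L_f, and that a KKT point exists. If for some strictly increasing sequence of indices k_j the subsequence (x^{k_j}, y^{k_j}, w^{k_j}) converges to (x^∞, y^∞, w^∞), then (x^∞, y^∞, w^∞) is itself a KKT point; in particular, (x^∞, y^∞) is an optimal solution of the problem of minimizing f(y) + P(y) over x ∈ C, y ∈ ℝ^N with Ax = y. -/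
open scoped RealInnerProductSpace
open Filter

namespace LPADMM

lemma small_t {a b : ℝ} (h : ∀ t : ℝ, 0 < t → t ≤ 1 → 0 ≤ t * a + t ^ 2 * b) : 0 ≤ a := by
  by_contra! ha
  have hb : 0 < |b| + 1 - a := by linarith [abs_nonneg b]
  have ht : 0 < -a / (|b| + 1 - a) := div_pos (by linarith) hb
  have h1 := h _ ht ((div_le_one hb).2 (by linarith [abs_nonneg b]))
  set t := -a / (|b| + 1 - a) with htd
  have h2 : t * (|b| + 1 - a) = -a := by rw [htd]; field_simp
  have h3 : 0 ≤ a + t * b := by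
    by_contra! hc
    nlinarith
  nlinarith [le_abs_self b]

variable {E F : Type*} [NormedAddCommGroup E] [InnerProductSpace ℝ E]
  [NormedAddCommGroup F] [InnerProductSpace ℝ F]

lemma prox_sub {P : E → ℝ} (hP : ConvexOn ℝ Set.univ P) {ρ : ℝ} {c y : E}
    (h : IsMinOn (fun z => ρ / 2 * ‖z - c‖ ^ 2 + P z) Set.univ y) (z : E) :
    P y + ρ * ⟪c - y, z - y⟫ ≤ P z := by
  have key : 0 ≤ (P z - P y - ρ * ⟪c - y, z - y⟫) := by
    refine small_t (b := ρ / 2 * ‖z - y‖ ^ 2) fun t ht ht1 => ?_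
    have h1 := isMinOn_iff.1 h ((1 - t) • y + t • z) (Set.mem_univ _)
    have h2 := hP.2 (Set.mem_univ y) (Set.mem_univ z) (by linarith : 0 ≤ 1 - t) ht.le (by ring)
    simp only [smul_eq_mul] at h1 h2
    have e : (1 - t) • y + t • z - c = t • (z - y) - (c - y) := by module
    have e2 : ‖y - c‖ = ‖c - y‖ := norm_sub_rev _ _
    rw [e, e2, norm_sub_sq_real (t • (z - y)), norm_smul, real_inner_smul_left, real_inner_comm, mul_pow,
      Real.norm_eq_abs, sq_abs] at h1
    nlinarith
  linarith

lemma proj_var {A : F →L[ℝ] E} {C : Set F} (hC : Convex ℝ C) {c : E} {x : F} (hx : x ∈ C)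
    (h : IsMinOn (fun u => ‖A u - c‖ ^ 2) C x) (u : F) (hu : u ∈ C) :
    0 ≤ ⟪A x - c, A u - A x⟫ := by
  have key : 0 ≤ 2 * ⟪A x - c, A u - A x⟫ := by
    refine small_t (b := ‖A u - A x‖ ^ 2) fun t ht ht1 => ?_
    have hm : (1 - t) • x + t • u ∈ C := hC hx hu (by linarith) ht.le (by ring)
    have h1 := isMinOn_iff.1 h _ hm
    have e : A ((1 - t) • x + t • u) - c = (A x - c) + t • (A u - A x) := by
      simp only [map_add, map_smul]; module
    rw [e, norm_add_sq_real, norm_smul, real_inner_smul_right, mul_pow,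
      Real.norm_eq_abs, sq_abs] at h1
    nlinarith
  linarith


lemma line_deriv [CompleteSpace E] {f : E → ℝ} {f' : E → E} (hg : ∀ z, HasGradientAt f (f' z) z) (a d : E) (t : ℝ) :
    HasDerivAt (fun s : ℝ => f (a + s • d)) ⟪f' (a + t • d), d⟫ t := by
  have h1 : HasDerivAt (fun s : ℝ => a + s • d) d t := by
    simpa using ((hasDerivAt_id t).smul_const d).const_add a
  have h2 := (hg (a + t • d)).hasFDerivAt.comp_hasDerivAt t h1
  rw [InnerProductSpace.toDual_apply_apply] at h2
  exact h2

lemma grad_ineq [CompleteSpace E] {f : E → ℝ} {f' : E → E} (hf : ConvexOn ℝ Set.univ f)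
    (hg : ∀ z, HasGradientAt f (f' z) z) (a b : E) : f a + ⟪f' a, b - a⟫ ≤ f b := by
  have h1 : ConvexOn ℝ Set.univ (fun s : ℝ => f (a + s • (b - a))) := by
    refine ⟨convex_univ, fun s _ t _ p q hp hq hpq => ?_⟩
    have h2 := hf.2 (Set.mem_univ (a + s • (b - a))) (Set.mem_univ (a + t • (b - a))) hp hq hpq
    convert h2 using 2
    have : p • a + q • a = a := by rw [← add_smul, hpq, one_smul]
    calc a + (p • s + q • t) • (b - a) = (p • a + q • a) + (p • s + q • t) • (b - a) := by rw [this]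
      _ = _ := by simp only [smul_eq_mul]; module
  have h3 := line_deriv hg a (b - a) 0
  have h4 := h1.le_slope_of_hasDerivAt (Set.mem_univ 0) (Set.mem_univ 1) one_pos h3
  simp [slope] at h4
  linarith

lemma descent [CompleteSpace E] {f : E → ℝ} {f' : E → E} (hg : ∀ z, HasGradientAt f (f' z) z) {L : ℝ}
    (hl : ∀ a b, ‖f' a - f' b‖ ≤ L * ‖a - b‖) (a d : E) :
    f (a + d) ≤ f a + ⟪f' a, d⟫ + L / 2 * ‖d‖ ^ 2 := by
  have hd : ∀ t : ℝ, HasDerivAt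
      (fun s : ℝ => f (a + s • d) - s * ⟪f' a, d⟫ - L / 2 * ‖d‖ ^ 2 * s ^ 2)
      (⟪f' (a + t • d), d⟫ - ⟪f' a, d⟫ - L * ‖d‖ ^ 2 * t) t := by
    intro t
    have := ((line_deriv hg a d t).sub ((hasDerivAt_id t).mul_const ⟪f' a, d⟫)).sub
      ((hasDerivAt_pow 2 t).const_mul (L / 2 * ‖d‖ ^ 2))
    refine this.congr_deriv ?_
    simp; ring
  have hanti : AntitoneOn
      (fun s : ℝ => f (a + s • d) - s * ⟪f' a, d⟫ - L / 2 * ‖d‖ ^ 2 * s ^ 2) (Set.Ici 0) := by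
    refine antitoneOn_of_deriv_nonpos (convex_Ici 0)
      (fun t _ => (hd t).continuousAt.continuousWithinAt)
      (fun t _ => (hd t).differentiableAt.differentiableWithinAt) fun t ht => ?_
    rw [(hd t).deriv]
    have ht0 : 0 < t := by simpa using ht
    have h1 := real_inner_le_norm (f' (a + t • d) - f' a) d
    have h2 := hl (a + t • d) a
    rw [add_sub_cancel_left, norm_smul, Real.norm_eq_abs, abs_of_pos ht0] at h2
    rw [inner_sub_left] at h1
    nlinarith [mul_le_mul_of_nonneg_right h2 (norm_nonneg d)]
  have := hanti (Set.mem_Ici.2 le_rfl) (Set.mem_Ici.2 zero_le_one) zero_le_one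
  simp at this
  linarith

lemma three_point [CompleteSpace E] {f : E → ℝ} {f' : E → E} (hf : ConvexOn ℝ Set.univ f)
    (hg : ∀ z, HasGradientAt f (f' z) z) {L : ℝ}
    (hl : ∀ a b, ‖f' a - f' b‖ ≤ L * ‖a - b‖) (y p s : E) :
    0 ≤ ⟪f' y - f' s, p - s⟫ + L / 4 * ‖p - y‖ ^ 2 := by
  obtain ⟨d, rfl⟩ : ∃ d, p = y + d := ⟨p - y, by abel⟩
  have h1 := descent hg hl y ((1 / 2 : ℝ) • d)
  have h2 := grad_ineq hf hg s (y + (1 / 2 : ℝ) • d)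
  have h3 := descent hg hl s (-((1 / 2 : ℝ) • d))
  have h4 := grad_ineq hf hg y (s + -((1 / 2 : ℝ) • d))
  rw [norm_neg] at h3
  rw [norm_smul] at h1 h3
  simp only [inner_sub_left, inner_sub_right, inner_add_right, inner_neg_right,
    real_inner_smul_right, mul_pow, add_sub_cancel_left] at *
  norm_num at *
  linarith

/-- one step energy estimate -/
lemma energy {L ρ : ℝ} (hL : 0 < L) (hρ : 0 < ρ) {y0 y1 y2 ys w1 w2 ws g0 g1 gs a : E}
    (hg : ‖g1 - g0‖ ≤ L * ‖y1 - y0‖)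
    (hw : w2 = w1 - ρ • (a - y2))
    (h3 : 0 ≤ ⟪g1 - gs, y2 - ys⟫ + L / 4 * ‖y2 - y1‖ ^ 2)
    (hx : 0 ≤ ⟪w2 - ws - ρ • (y2 - y1), a - ys⟫)
    (hy : 0 ≤ ⟪-w2 - g1 + ws + gs, y2 - ys⟫)
    (hm : 0 ≤ ⟪-w2 - g1 + w1 + g0, y2 - y1⟫) :
    (‖w2 - ws‖ ^ 2 + ρ ^ 2 * ‖y2 - ys‖ ^ 2 + ρ * L * ‖y2 - y1‖ ^ 2)
      + (‖w2 - w1‖ ^ 2 + ρ * (ρ - 5 / 2 * L) * ‖y2 - y1‖ ^ 2) ≤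
    ‖w1 - ws‖ ^ 2 + ρ ^ 2 * ‖y1 - ys‖ ^ 2 + ρ * L * ‖y1 - y0‖ ^ 2 := by
  have hcs : -⟪g1 - g0, y2 - y1⟫ ≤ L / 2 * (‖y1 - y0‖ ^ 2 + ‖y2 - y1‖ ^ 2) := by
    have h1 := abs_le.1 (abs_real_inner_le_norm (g1 - g0) (y2 - y1))
    have h2 := mul_le_mul_of_nonneg_right hg (norm_nonneg (y2 - y1))
    nlinarith [mul_nonneg hL.le (sq_nonneg (‖y1 - y0‖ - ‖y2 - y1‖))]
  obtain ⟨p, rfl⟩ : ∃ p, y1 = ys + p := ⟨y1 - ys, by abel⟩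
  obtain ⟨d, rfl⟩ : ∃ d, y2 = ys + p + d := ⟨y2 - (ys + p), by abel⟩
  obtain ⟨r, rfl⟩ : ∃ r, a = ys + p + d + r := ⟨a - (ys + p + d), by abel⟩
  obtain ⟨v, rfl⟩ : ∃ v, w1 = ws + v := ⟨w1 - ws, by abel⟩
  subst hw
  have e1 : ys + p + d - ys = p + d := by abel
  have e2 : ys + p + d - (ys + p) = d := by abel
  have e3 : ys + p + d + r - (ys + p + d) = r := by abel
  have e4 : ys + p + d + r - ys = p + d + r := by abel
  have e5 : ys + p - ys = p := by abel
  simp only [e1, e2, e3, e4, e5, add_sub_cancel_left] at *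
  have e6 : ws + v - ρ • r - ws = v - ρ • r := by abel
  have e7 : ws + v - ρ • r - (ws + v) = - (ρ • r) := by abel
  have e8 : -(ws + v - ρ • r) - g1 + ws + gs = ρ • r - v - (g1 - gs) := by abel
  have e9 : -(ws + v - ρ • r) - g1 + (ws + v) + g0 = ρ • r - (g1 - g0) := by abel
  rw [e6, e7]
  rw [e6] at hx
  rw [e8] at hy
  rw [e9] at hm
  rw [norm_neg, norm_sub_sq_real, norm_add_sq_real, norm_smul]
  generalize g1 - gs = G at *
  generalize g1 - g0 = H at *
  simp only [inner_sub_left, inner_add_right, real_inner_smul_left, real_inner_smul_right,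
    mul_pow, Real.norm_eq_abs, sq_abs, real_inner_self_eq_norm_sq] at *
  rw [real_inner_comm p r, real_inner_comm d r, real_inner_comm d p] at *
  nlinarith [mul_nonneg hρ.le hx]

end LPADMM

/-- Step 1 in the proof of Theorem 4.3(a): any subsequential limit
`(x^∞, y^∞, w^∞)` of the LP-ADMM iterates (with `ρ > (√3 + 1)L_f` and assuming
a KKT point exists) is itself a KKT point; in particular `(x^∞, y^∞)` is
optimal for minimizing `f(y) + P(y)` over `x ∈ C`, `Ax = y`. -/
theorem lpadmm_subsequential_limit_is_kkt
    {n N : ℕ} (hn : 0 < n) (hN : 0 < N)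
    (A : EuclideanSpace ℝ (Fin n) →L[ℝ] EuclideanSpace ℝ (Fin N))
    (C : Set (EuclideanSpace ℝ (Fin n)))
    (hCne : C.Nonempty) (hCconv : Convex ℝ C) (hCclosed : IsClosed C)
    (P : EuclideanSpace ℝ (Fin N) → ℝ) (hP : ConvexOn ℝ Set.univ P)
    (f : EuclideanSpace ℝ (Fin N) → ℝ) (hf : ConvexOn ℝ Set.univ f)
    (f' : EuclideanSpace ℝ (Fin N) → EuclideanSpace ℝ (Fin N))
    (hgrad : ∀ z, HasGradientAt f (f' z) z)
    (Lf : ℝ) (hLf : 0 < Lf)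
    (hlip : ∀ a b, ‖f' a - f' b‖ ≤ Lf * ‖a - b‖)
    (ρ : ℝ) (hρ : (Real.sqrt 3 + 1) * Lf < ρ)
    (x : ℕ → EuclideanSpace ℝ (Fin n)) (y w : ℕ → EuclideanSpace ℝ (Fin N))
    (hx : ∀ k, x (k+1) ∈ C ∧
      IsMinOn (fun u => ‖A u - y k - ρ⁻¹ • w k‖ ^ 2) C (x (k+1)))
    (hy : ∀ k, IsMinOn
      (fun z => ρ / 2 * ‖z - (A (x (k+1)) - ρ⁻¹ • (w k + f' (y k)))‖ ^ 2 + P z)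
      Set.univ (y (k+1)))
    (hw : ∀ k, w (k+1) = w k - ρ • (A (x (k+1)) - y (k+1)))
    (hkkt_exists : ∃ (xs : EuclideanSpace ℝ (Fin n))
        (ys ws : EuclideanSpace ℝ (Fin N)),
      xs ∈ C ∧ A xs = ys ∧ (∀ xx ∈ C, ⟪ws, A xx - A xs⟫ ≤ 0) ∧
        (∀ z, P ys + ⟪-ws - f' ys, z - ys⟫ ≤ P z))
    (kj : ℕ → ℕ) (hkj : StrictMono kj)
    (xinf : EuclideanSpace ℝ (Fin n)) (yinf winf : EuclideanSpace ℝ (Fin N))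
    (hxconv : Tendsto (fun j => x (kj j)) atTop (nhds xinf))
    (hyconv : Tendsto (fun j => y (kj j)) atTop (nhds yinf))
    (hwconv : Tendsto (fun j => w (kj j)) atTop (nhds winf)) :
    xinf ∈ C ∧ A xinf = yinf ∧
      (∀ xx ∈ C, ⟪winf, A xx - A xinf⟫ ≤ 0) ∧
      (∀ z, P yinf + ⟪-winf - f' yinf, z - yinf⟫ ≤ P z) ∧
      (∀ xx ∈ C, ∀ yy : EuclideanSpace ℝ (Fin N), A xx = yy →
        f yinf + P yinf ≤ f yy + P yy) := by
  obtain ⟨xs, ys, ws, hxs, hys, hws, hPs⟩ := hkkt_exists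
  have hs3 : (3 / 2 : ℝ) < Real.sqrt 3 := by
    apply Real.lt_sqrt_of_sq_lt; norm_num
  have hρL : 5 / 2 * Lf < ρ := by nlinarith
  have hρ0 : 0 < ρ := by linarith
  -- optimality conditions of the subproblems
  have hysub : ∀ k z, P (y (k+1)) + ⟪-w (k+1) - f' (y k), z - y (k+1)⟫ ≤ P z := by
    intro k z
    have h := LPADMM.prox_sub hP (hy k) z
    rw [← real_inner_smul_left] at h
    convert h using 4
    rw [hw k]
    simp only [smul_sub, smul_smul, mul_inv_cancel₀ hρ0.ne', one_smul]
    abel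
  have hxvar : ∀ k, ∀ u ∈ C, 0 ≤ ⟪-w (k+1) + ρ • (y (k+1) - y k), A u - A (x (k+1))⟫ := by
    intro k u hu
    have h := LPADMM.proj_var (A := A) (c := y k + ρ⁻¹ • w k) hCconv (hx k).1
      (by simpa only [sub_sub] using (hx k).2) u hu
    have h' := mul_nonneg hρ0.le h
    rw [← real_inner_smul_left] at h'
    refine h'.trans_eq ?_
    congr 1
    rw [hw k]
    simp only [smul_sub, smul_add, smul_smul, mul_inv_cancel₀ hρ0.ne', one_smul]
    abel
  -- energy decrease
  let En : ℕ → ℝ := fun k => ‖w (k+1) - ws‖ ^ 2 + ρ ^ 2 * ‖y (k+1) - ys‖ ^ 2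
    + ρ * Lf * ‖y (k+1) - y k‖ ^ 2
  let D : ℕ → ℝ := fun k => ‖w (k+2) - w (k+1)‖ ^ 2
    + ρ * (ρ - 5 / 2 * Lf) * ‖y (k+2) - y (k+1)‖ ^ 2
  have hc : 0 < ρ * (ρ - 5 / 2 * Lf) := mul_pos hρ0 (by linarith)
  have hEn : ∀ k, En (k+1) + D k ≤ En k := by
    intro k
    refine LPADMM.energy hLf hρ0 (a := A (x (k+2))) (gs := f' ys) (hlip (y (k+1)) (y k))
      (hw (k+1)) (LPADMM.three_point hf hgrad hlip _ _ _) ?_ ?_ ?_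
    · have h1 := hxvar (k+1) xs hxs
      have h2 := hws _ (hx (k+1)).1
      rw [hys] at h1 h2
      have e : ys - A (x (k+1+1)) = -(A (x (k+1+1)) - ys) := by abel
      rw [e, inner_neg_right] at h1
      have e' : w (k+2) - ws - ρ • (y (k+2) - y (k+1))
        = -(-w (k+2) + ρ • (y (k+2) - y (k+1))) - ws := by abel
      rw [e', inner_sub_left, inner_neg_left]
      linarith
    · have h1 := hysub (k+1) ys
      have h2 := hPs (y (k+2))
      have e : ys - y (k+1+1) = -(y (k+1+1) - ys) := by abel
      rw [e, inner_neg_right] at h1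
      have e' : -w (k+2) - f' (y (k+1)) + ws + f' ys
        = (-w (k+2) - f' (y (k+1))) - (-ws - f' ys) := by abel
      rw [e', inner_sub_left]
      linarith
    · have h1 := hysub (k+1) (y (k+1))
      have h2 := hysub k (y (k+2))
      have e : y (k+1) - y (k+1+1) = -(y (k+1+1) - y (k+1)) := by abel
      rw [e, inner_neg_right] at h1
      have e' : -w (k+2) - f' (y (k+1)) + w (k+1) + f' (y k)
        = (-w (k+2) - f' (y (k+1))) - (-w (k+1) - f' (y k)) := by abel
      rw [e', inner_sub_left]
      linarith
  have hD0 : ∀ k, 0 ≤ D k := fun k =>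
    add_nonneg (sq_nonneg _) (mul_nonneg hc.le (sq_nonneg _))
  have hE0 : ∀ k, 0 ≤ En k := fun k => by
    have := mul_pos hρ0 hLf
    positivity
  have hElim := tendsto_atTop_ciInf (antitone_nat_of_succ_le fun k => by linarith [hEn k, hD0 k])
    (⟨0, by rintro _ ⟨k, rfl⟩; exact hE0 k⟩ : BddBelow (Set.range En))
  have hDlim : Tendsto D atTop (nhds 0) := by
    have h := hElim.sub ((tendsto_add_atTop_iff_nat 1).2 hElim)
    rw [sub_self] at h
    exact squeeze_zero hD0 (fun k => by linarith [hEn k]) h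
  have hdw2 : Tendsto (fun k => ‖w (k+2) - w (k+1)‖ ^ 2) atTop (nhds 0) :=
    squeeze_zero (fun k => sq_nonneg _)
      (fun k => le_add_of_nonneg_right (mul_nonneg hc.le (sq_nonneg _))) hDlim
  have hdy2 : Tendsto (fun k => ‖y (k+2) - y (k+1)‖ ^ 2) atTop (nhds 0) := by
    have h := hDlim.const_mul (ρ * (ρ - 5 / 2 * Lf))⁻¹
    rw [mul_zero] at h
    refine squeeze_zero (fun k => sq_nonneg _) (fun k => ?_) h
    rw [le_inv_mul_iff₀ hc]
    exact le_add_of_nonneg_left (sq_nonneg _)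
  have sqz : ∀ v : ℕ → EuclideanSpace ℝ (Fin N),
      Tendsto (fun k => ‖v (k+1)‖ ^ 2) atTop (nhds 0) → Tendsto v atTop (nhds 0) := by
    intro v hv
    rw [← tendsto_add_atTop_iff_nat 1, tendsto_zero_iff_norm_tendsto_zero]
    have := hv.sqrt
    simpa [Real.sqrt_sq] using this
  have hdw : Tendsto (fun k => w (k+1) - w k) atTop (nhds 0) := sqz _ hdw2
  have hdy : Tendsto (fun k => y (k+1) - y k) atTop (nhds 0) := sqz _ hdy2
  -- shifted subsequence
  obtain ⟨m, hm⟩ : ∃ m : ℕ → ℕ, ∀ j, kj (j+1) = m j + 1 :=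
    ⟨fun j => kj (j+1) - 1, fun j => by have := hkj.id_le (j+1); simp only [id] at this ⊢; omega⟩
  have hmt : Tendsto m atTop atTop := by
    refine tendsto_atTop_mono (fun j => ?_) tendsto_id
    have := hkj.id_le (j+1)
    simp only [id] at this ⊢
    have := hm j
    omega
  have hX : Tendsto (fun j => x (m j + 1)) atTop (nhds xinf) := by
    simpa only [hm] using (tendsto_add_atTop_iff_nat 1).2 hxconv
  have hY : Tendsto (fun j => y (m j + 1)) atTop (nhds yinf) := by
    simpa only [hm] using (tendsto_add_atTop_iff_nat 1).2 hyconv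
  have hW : Tendsto (fun j => w (m j + 1)) atTop (nhds winf) := by
    simpa only [hm] using (tendsto_add_atTop_iff_nat 1).2 hwconv
  have hdwm : Tendsto (fun j => w (m j + 1) - w (m j)) atTop (nhds 0) := hdw.comp hmt
  have hdym : Tendsto (fun j => y (m j + 1) - y (m j)) atTop (nhds 0) := hdy.comp hmt
  have hY0 : Tendsto (fun j => y (m j)) atTop (nhds yinf) := by
    simpa using hY.sub hdym
  have hAX : Tendsto (fun j => A (x (m j + 1))) atTop (nhds (A xinf)) :=
    (A.continuous.tendsto _).comp hX
  have hf'c : Continuous f' := by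
    have : LipschitzWith (Real.toNNReal Lf) f' := LipschitzWith.of_dist_le_mul fun a b => by
      rw [dist_eq_norm, dist_eq_norm, Real.coe_toNNReal _ hLf.le]
      exact hlip a b
    exact this.continuous
  have hPc : Continuous P := by
    rw [← continuousOn_univ]
    exact hP.continuousOn isOpen_univ
  have r1 : xinf ∈ C := hCclosed.mem_of_tendsto hX (Eventually.of_forall fun j => (hx _).1)
  have r2 : A xinf = yinf := by
    have h : Tendsto (fun j => y (m j + 1) - ρ⁻¹ • (w (m j + 1) - w (m j))) atTop (nhds yinf) := by
      simpa using hY.sub (hdwm.const_smul ρ⁻¹)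
    refine tendsto_nhds_unique hAX (h.congr fun j => ?_)
    rw [hw (m j)]
    have : w (m j) - ρ • (A (x (m j + 1)) - y (m j + 1)) - w (m j)
      = -(ρ • (A (x (m j + 1)) - y (m j + 1))) := by abel
    rw [this, smul_neg, smul_smul, inv_mul_cancel₀ hρ0.ne', one_smul]
    abel
  have r3 : ∀ xx ∈ C, ⟪winf, A xx - A xinf⟫ ≤ 0 := by
    intro u hu
    have h : Tendsto (fun j => ⟪-w (m j + 1) + ρ • (y (m j + 1) - y (m j)),
        A u - A (x (m j + 1))⟫) atTop (nhds ⟪-winf + ρ • (0 : EuclideanSpace ℝ (Fin N)),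
          A u - A xinf⟫) :=
      (hW.neg.add (hdym.const_smul ρ)).inner (tendsto_const_nhds.sub hAX)
    have h' := ge_of_tendsto' h fun j => hxvar (m j) u hu
    rw [smul_zero, add_zero, inner_neg_left] at h'
    linarith
  have r4 : ∀ z, P yinf + ⟪-winf - f' yinf, z - yinf⟫ ≤ P z := by
    intro z
    have h : Tendsto (fun j => P (y (m j + 1)) + ⟪-w (m j + 1) - f' (y (m j)),
        z - y (m j + 1)⟫) atTop (nhds (P yinf + ⟪-winf - f' yinf, z - yinf⟫)) :=
      ((hPc.tendsto _).comp hY).add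
        ((hW.neg.sub ((hf'c.tendsto _).comp hY0)).inner (tendsto_const_nhds.sub hY))
    exact le_of_tendsto' h fun j => hysub (m j) z
  refine ⟨r1, r2, r3, r4, ?_⟩
  rintro u hu _ rfl
  have h1 := r3 u hu
  have h2 := r4 (A u)
  have h3 := LPADMM.grad_ineq hf hgrad yinf (A u)
  rw [r2] at h1
  rw [inner_sub_left, inner_neg_left] at h2
  linarith
end
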